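/- Let A be a Bernstein algebra over a field K of characteristic ≠ 2, 3 which is Noetherian or Artinian, with Peirce decomposition A = Ke ⊕ U ⊕ V relative to an idempotent e of weight 1, and barideal N = U ⊕ V. If I is a K-subspace of A satisfying NI = I (where NI is the linear span of products xy with x ∈ N, y ∈ I), then I ⊆ ann_U(U) = {u ∈ U : uU = 0} and I is an ideal of A. -/

import Mathlib

/-- The product of two subspaces of a (possibly non-associative, non-unital) algebra:
the linear span of all products `x * y` with `x ∈ M`, `y ∈ N`. -/
def subMul {K A : Type*} [Field K] [NonUnitalNonAssocRing A] [Module K A]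
    [SMulCommClass K A A] [IsScalarTower K A A]
    (M N : Submodule K A) : Submodule K A :=
  Submodule.map₂ (LinearMap.mul K A) M N

/-- The Peirce component `U = {u : A | e * u = (1/2) • u}` relative to an idempotent `e`. -/
def peirceU (K : Type*) {A : Type*} [Field K] [NonUnitalNonAssocCommRing A] [Module K A]
    [SMulCommClass K A A] [IsScalarTower K A A] (e : A) : Submodule K A where
  carrier := {u : A | e * u = (2 : K)⁻¹ • u}
  add_mem' := by
    intro a b ha hb
    simp only [Set.mem_setOf_eq] at *
    rw [mul_add, ha, hb, smul_add]
  zero_mem' := by simp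
  smul_mem' := by
    intro c x hx
    simp only [Set.mem_setOf_eq] at *
    rw [mul_smul_comm, hx, smul_comm]

/-- The Peirce component `V = {v : A | e * v = 0}` relative to an idempotent `e`. -/
def peirceV (K : Type*) {A : Type*} [Field K] [NonUnitalNonAssocCommRing A] [Module K A]
    [SMulCommClass K A A] [IsScalarTower K A A] (e : A) : Submodule K A where
  carrier := {v : A | e * v = 0}
  add_mem' := by
    intro a b ha hb
    simp only [Set.mem_setOf_eq] at *
    rw [mul_add, ha, hb, add_zero]
  zero_mem' := by simp
  smul_mem' := by
    intro c x hx
    simp only [Set.mem_setOf_eq] at *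
    rw [mul_smul_comm, hx, smul_zero]

section Words

variable {K R ι κ : Type*} [Field K] [Ring R] [Algebra K R]

/-- The product of blocks `a i * b k₁ * ⋯ * b kᵣ`. -/
def blockProd (a : ι → R) (b : κ → R) (l : List (ι × List κ)) : R :=
  (l.map fun p => a p.1 * (p.2.map b).prod).prod

/-- The number of letters `b k` in a list of blocks. -/
def blockCount (l : List (ι × List κ)) : ℕ := (l.map fun p => p.2.length).sum

/-- The span of the words with fewer than `k` letters `a i` and of total weight `w`, where the
letters `a i` have weight `1` and the letters `b j` have weight `2`. -/
def lowerWords (K : Type*) {R ι κ : Type*} [Field K] [Ring R] [Algebra K R]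
    (a : ι → R) (b : κ → R) (k w : ℕ) : Submodule K R :=
  Submodule.span K {x | ∃ (μ : List κ) (l : List (ι × List κ)), l.length < k ∧
    l.length + 2 * (μ.length + blockCount l) = w ∧ x = (μ.map b).prod * blockProd a b l}

variable {a : ι → R} {b : κ → R}

@[simp] lemma blockProd_nil : blockProd a b [] = 1 := rfl

@[simp] lemma blockProd_cons (p : ι × List κ) (l : List (ι × List κ)) :
    blockProd a b (p :: l) = a p.1 * (p.2.map b).prod * blockProd a b l := by
  simp [blockProd]

@[simp] lemma blockCount_nil : blockCount ([] : List (ι × List κ)) = 0 := rfl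

@[simp] lemma blockCount_cons (p : ι × List κ) (l : List (ι × List κ)) :
    blockCount (p :: l) = p.2.length + blockCount l := by
  simp [blockCount]

lemma prod_mul_mem_lowerWords {k w : ℕ} (μ : List κ) {x : R} (hx : x ∈ lowerWords K a b k w) :
    (μ.map b).prod * x ∈ lowerWords K a b k (w + 2 * μ.length) := by
  induction hx using Submodule.span_induction with
  | mem x hx =>
    obtain ⟨ν, l, hl, hw, rfl⟩ := hx
    refine Submodule.subset_span ⟨μ ++ ν, l, hl, ?_, ?_⟩
    · simp only [List.length_append]; omega
    · simp [mul_assoc]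
  | zero => simp
  | add x y _ _ hx hy => rw [mul_add]; exact add_mem hx hy
  | smul c x _ hx => rw [mul_smul_comm]; exact Submodule.smul_mem _ _ hx

lemma block_mul_mem_lowerWords {k w : ℕ} (i : ι) (μ : List κ) {x : R}
    (hx : x ∈ lowerWords K a b k w) :
    a i * (μ.map b).prod * x ∈ lowerWords K a b (k + 1) (w + 1 + 2 * μ.length) := by
  induction hx using Submodule.span_induction with
  | mem x hx =>
    obtain ⟨ν, l, hl, hw, rfl⟩ := hx
    refine Submodule.subset_span ⟨[], (i, μ ++ ν) :: l, by simpa using hl, ?_, ?_⟩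
    · simp only [List.length_append, List.length_cons, blockCount_cons, List.length_nil]; omega
    · simp [mul_assoc]
  | zero => simp
  | add x y _ _ hx hy => rw [mul_add]; exact add_mem hx hy
  | smul c x _ hx => rw [mul_smul_comm]; exact Submodule.smul_mem _ _ hx

lemma cons_mem_lowerWords {k w k' w' : ℕ} (i : ι) (μ : List κ) {l : List (ι × List κ)}
    (hl : blockProd a b l ∈ lowerWords K a b k w) (hk : k' = k + 1)
    (hw : w' = w + 1 + 2 * μ.length) :
    blockProd a b ((i, μ) :: l) ∈ lowerWords K a b k' w' := by
  subst hk hw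
  simpa using block_mul_mem_lowerWords i μ hl

lemma smul_add_mem_lowerWords_of_swap (c : ι → ι → κ)
    (haa : ∀ i j, a i * a j + a j * a i = -b (c i j))
    (hswap : ∀ i j (μ : List κ), μ ≠ [] → a i * (μ.map b).prod * a j = a j * (μ.map b).prod * a i ∨
      a i * (μ.map b).prod * a j = -(a j * (μ.map b).prod * a i))
    (i j : ι) (μ ν : List κ) (r : List (ι × List κ)) :
    ∃ s : K, blockProd a b ((i, μ) :: (j, ν) :: r) - s • blockProd a b ((j, μ) :: (i, ν) :: r) ∈
      lowerWords K a b (r.length + 2) (r.length + 2 + 2 * (μ.length + ν.length + blockCount r)) := by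
  rcases eq_or_ne μ [] with rfl | hμ
  · refine ⟨-1, ?_⟩
    have h : blockProd a b ((i, []) :: (j, ν) :: r) - (-1 : K) • blockProd a b ((j, []) :: (i, ν) :: r)
        = -(((c i j :: ν).map b).prod * blockProd a b r) := by
      have := congrArg (· * ((ν.map b).prod * blockProd a b r)) (haa i j)
      simp only [add_mul, neg_mul] at this
      simp only [blockProd_cons, List.map_nil, List.prod_nil, mul_one, List.map_cons,
        List.prod_cons, neg_smul, one_smul, sub_neg_eq_add, mul_assoc] at this ⊢
      exact this
    rw [h]
    refine neg_mem (Submodule.subset_span ⟨c i j :: ν, r, by omega, ?_, rfl⟩)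
    simp only [List.length_cons, List.length_nil]; omega
  · rcases hswap i j μ hμ with h | h
    · refine ⟨1, ?_⟩
      have h' := congrArg (· * ((ν.map b).prod * blockProd a b r)) h
      simp only [mul_assoc] at h'
      simp [mul_assoc, h']
    · refine ⟨-1, ?_⟩
      have h' := congrArg (· * ((ν.map b).prod * blockProd a b r)) h
      simp only [mul_assoc, neg_mul] at h'
      simp [mul_assoc, h']

lemma prod_mul_prod_eq_zero (hbab : ∀ k i l, b k * a i * b l = 0) (i : ι) {μ ν : List κ}
    (hμ : μ ≠ []) (hν : ν ≠ []) : (μ.map b).prod * a i * (ν.map b).prod = 0 := by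
  obtain ⟨k, ν, rfl⟩ := List.exists_cons_of_ne_nil hν
  induction μ with
  | nil => exact absurd rfl hμ
  | cons j μ ih =>
    rcases eq_or_ne μ [] with rfl | h
    · simp [← mul_assoc, hbab]
    · rw [List.map_cons, List.prod_cons, mul_assoc, mul_assoc, ← mul_assoc _ (a i), ih h, mul_zero]

lemma blockProd_triple_mem_lowerWords (h2 : (2 : K) ≠ 0) (c : ι → ι → κ)
    (haa : ∀ i j, a i * a j + a j * a i = -b (c i j))
    (hbab : ∀ k i l, b k * a i * b l = 0)
    (i : ι) (μ ν ξ : List κ) (r : List (ι × List κ)) :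
    blockProd a b ((i, μ) :: (i, ν) :: (i, ξ) :: r) ∈ lowerWords K a b (r.length + 3)
      (r.length + 3 + 2 * (μ.length + ν.length + ξ.length + blockCount r)) := by
  have hdbl : ∀ (ν : List κ) (r : List (ι × List κ)), blockProd a b ((i, []) :: (i, ν) :: r) ∈
      lowerWords K a b (r.length + 2) (r.length + 2 + 2 * (ν.length + blockCount r)) := by
    intro ν r
    have h : blockProd a b ((i, []) :: (i, ν) :: r)
        = (-(2 : K)⁻¹) • (((c i i :: ν).map b).prod * blockProd a b r) := by
      have h1 : a i * a i = (-(2 : K)⁻¹) • b (c i i) := by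
        have h3 : (2 : K) • (a i * a i) = -b (c i i) := by rw [two_smul]; exact haa i i
        rw [neg_smul, ← smul_neg, ← h3, inv_smul_smul₀ h2]
      simp only [blockProd_cons, List.map_nil, List.prod_nil, mul_one, List.map_cons,
        List.prod_cons]
      rw [← mul_assoc, ← mul_assoc, h1]
      simp [mul_assoc]
    rw [h]
    refine Submodule.smul_mem _ _ (Submodule.subset_span ⟨c i i :: ν, r, by omega, ?_, rfl⟩)
    simp only [List.length_cons]; omega
  rcases eq_or_ne μ [] with rfl | hμ
  · have := hdbl ν ((i, ξ) :: r)
    simp only [List.length_cons, blockCount_cons] at this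
    convert this using 2
    simp only [List.length_nil]; ring
  rcases eq_or_ne ν [] with rfl | hν
  · refine cons_mem_lowerWords i μ (hdbl ξ r) rfl ?_
    simp only [List.length_nil]; ring
  · have := prod_mul_prod_eq_zero hbab i hμ hν
    have h0 : blockProd a b ((i, μ) :: (i, ν) :: (i, ξ) :: r) = 0 := by
      rw [blockProd_cons, blockProd_cons]
      calc _ = a i * ((μ.map b).prod * a i * (ν.map b).prod) * blockProd a b ((i, ξ) :: r) := by
            simp only [mul_assoc]
        _ = 0 := by rw [this]; simp
    rw [h0]; exact zero_mem _

lemma blockProd_cons_mem_lowerWords [DecidableEq ι] (h2 : (2 : K) ≠ 0) (c : ι → ι → κ)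
    (haa : ∀ i j, a i * a j + a j * a i = -b (c i j))
    (hswap : ∀ i j (μ : List κ), μ ≠ [] → a i * (μ.map b).prod * a j = a j * (μ.map b).prod * a i ∨
      a i * (μ.map b).prod * a j = -(a j * (μ.map b).prod * a i))
    (hbab : ∀ k i l, b k * a i * b l = 0) (i : ι) :
    ∀ (n : ℕ) (l : List (ι × List κ)) (μ : List κ), l.length = n →
      2 ≤ (l.map Prod.fst).count i → blockProd a b ((i, μ) :: l) ∈ lowerWords K a b (l.length + 1)
        (l.length + 1 + 2 * (μ.length + blockCount l)) := by
  intro n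
  induction n using Nat.strong_induction_on with
  | _ n ih =>
  have hmem : ∀ (i j : ι) (μ ν : List κ) (r : List (ι × List κ)) (k w : ℕ), k = r.length + 2 →
      w = r.length + 2 + 2 * (μ.length + ν.length + blockCount r) →
      blockProd a b ((j, μ) :: (i, ν) :: r) ∈ lowerWords K a b k w →
      blockProd a b ((i, μ) :: (j, ν) :: r) ∈ lowerWords K a b k w := by
    rintro i j μ ν r _ _ rfl rfl h
    obtain ⟨s, hs⟩ := smul_add_mem_lowerWords_of_swap (K := K) c haa hswap i j μ ν r
    simpa using add_mem hs (Submodule.smul_mem _ s h)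
  rintro (_ | ⟨⟨j, ν⟩, r⟩) μ hn hcount
  · simp at hcount
  simp only [List.length_cons] at hn
  simp only [List.length_cons, blockCount_cons]
  by_cases hj : j = i
  · subst hj
    obtain _ | ⟨⟨k, ξ⟩, r⟩ := r
    · simp at hcount
    by_cases hk : k = j
    · subst hk
      convert blockProd_triple_mem_lowerWords h2 c haa hbab k μ ν ξ r using 2
      all_goals simp only [blockCount_cons, List.length_cons]
      ring
    · simp only [List.map_cons, List.count_cons_self, List.count_cons_of_ne hk] at hcount
      simp only [List.length_cons] at hn ⊢
      simp only [blockCount_cons]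
      obtain ⟨s, hs⟩ := smul_add_mem_lowerWords_of_swap (K := K) c haa hswap j k ν ξ r
      have h1 : blockProd a b ((j, ν) :: (j, ξ) :: r) ∈ _ :=
        ih (r.length + 1) (by omega) ((j, ξ) :: r) ν (by simp)
          (by simp only [List.map_cons, List.count_cons_self]; omega)
      have h3 := cons_mem_lowerWords k μ h1 rfl rfl
      have h4 := hmem j k μ ν ((j, ξ) :: r) _ _ (by simp)
        (by simp only [List.length_cons, blockCount_cons]; ring) h3
      have h5 := block_mul_mem_lowerWords j μ hs
      rw [mul_sub, mul_smul_comm] at h5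
      have h6 := Submodule.smul_mem _ s h4
      rw [blockProd_cons] at h6
      convert add_mem h5 (by convert h6 using 1; congr 1
                             · simp only [List.length_cons, blockCount_cons]; ring) using 1
      · congr 1; ring
      · rw [blockProd_cons]; abel
  · simp only [List.map_cons, List.count_cons_of_ne hj] at hcount
    have h1 := ih r.length (by omega) r ν rfl hcount
    have h3 := cons_mem_lowerWords j μ h1 rfl rfl
    convert hmem i j μ ν r _ _ (by simp) (by ring) h3 using 1
    congr 1; ring

lemma blockProd_mem_lowerWords [DecidableEq ι] (h2 : (2 : K) ≠ 0) (c : ι → ι → κ)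
    (haa : ∀ i j, a i * a j + a j * a i = -b (c i j))
    (hswap : ∀ i j (μ : List κ), μ ≠ [] → a i * (μ.map b).prod * a j = a j * (μ.map b).prod * a i ∨
      a i * (μ.map b).prod * a j = -(a j * (μ.map b).prod * a i))
    (hbab : ∀ k i l, b k * a i * b l = 0) (i : ι) (l : List (ι × List κ))
    (hl : 3 ≤ (l.map Prod.fst).count i) :
    blockProd a b l ∈ lowerWords K a b l.length (l.length + 2 * blockCount l) := by
  induction l with
  | nil => simp at hl
  | cons p l ih =>
    obtain ⟨j, μ⟩ := p
    by_cases hj : j = i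
    · subst hj
      simp only [List.map_cons, List.count_cons_self] at hl
      simpa using blockProd_cons_mem_lowerWords h2 c haa hswap hbab j _ l μ rfl (by omega)
    · simp only [List.map_cons, List.count_cons_of_ne hj] at hl
      refine cons_mem_lowerWords j μ (ih hl) (by simp) ?_
      simp only [List.length_cons, blockCount_cons]; ring

lemma prod_eq_zero_of_card_lt [Fintype κ] (hbb : ∀ k l, b k * b l = -(b l * b k))
    (hb : ∀ k, b k * b k = 0) (μ : List κ) (hμ : Fintype.card κ < μ.length) :
    (μ.map b).prod = 0 := by
  have hmul : ∀ (k : κ) (μ : List κ), k ∈ μ → b k * (μ.map b).prod = 0 := by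
    intro k μ
    induction μ with
    | nil => simp
    | cons l μ ih =>
      intro hk
      rw [List.map_cons, List.prod_cons, ← mul_assoc]
      rcases List.mem_cons.1 hk with rfl | hk
      · rw [hb, zero_mul]
      · rw [hbb, neg_mul, mul_assoc, ih hk, mul_zero, neg_zero]
  have hdup : ¬ μ.Nodup := fun h => absurd h.length_le_card (by omega)
  clear hμ
  induction μ with
  | nil => simp at hdup
  | cons k μ ih =>
    rw [List.map_cons, List.prod_cons]
    by_cases hk : k ∈ μ
    · exact hmul k μ hk
    · rw [ih fun h => hdup (List.nodup_cons.2 ⟨hk, h⟩), mul_zero]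

/-- Words in two finite families `a`, `b` of elements of an algebra vanish as soon as they are long
enough, if the `b k` anticommute and square to zero, the `a i` anticommute modulo the `b k`,
interchanging two letters `a i`, `a j` separated only by letters `b k` changes at most the sign,
and `b k * a i * b l = 0`. -/
theorem exists_forall_prod_eq_zero [Fintype ι] [Fintype κ] (h2 : (2 : K) ≠ 0) (c : ι → ι → κ)
    (hbb : ∀ k l, b k * b l = -(b l * b k)) (hb : ∀ k, b k * b k = 0)
    (haa : ∀ i j, a i * a j + a j * a i = -b (c i j))
    (hswap : ∀ i j (μ : List κ), μ ≠ [] → a i * (μ.map b).prod * a j = a j * (μ.map b).prod * a i ∨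
      a i * (μ.map b).prod * a j = -(a j * (μ.map b).prod * a i))
    (hbab : ∀ k i l, b k * a i * b l = 0) :
    ∃ M : ℕ, ∀ l : List (ι ⊕ κ), M ≤ l.length → (l.map (Sum.elim a b)).prod = 0 := by
  classical
  let n := Fintype.card ι
  let d := Fintype.card κ
  let M := 2 * n + 2 * ((2 * n + 1) * d) + 1
  have key : ∀ (k : ℕ) (μ : List κ) (l : List (ι × List κ)), l.length = k →
      M ≤ l.length + 2 * (μ.length + blockCount l) → (μ.map b).prod * blockProd a b l = 0 := by
    intro k
    induction k using Nat.strong_induction_on with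
    | _ k ih =>
    intro μ l hl hM
    by_cases hk : 2 * n < k
    · obtain ⟨i, hi⟩ : ∃ i, 3 ≤ (l.map Prod.fst).count i := by
        by_contra! h
        have h1 : ∑ i : ι, (l.map Prod.fst).count i = (l.map Prod.fst).length := by
          simpa using Multiset.sum_count_eq_card (s := Finset.univ)
            (m := ((l.map Prod.fst : List ι) : Multiset ι)) (by simp)
        have h3 : ∑ i : ι, (l.map Prod.fst).count i ≤ ∑ _i : ι, 2 :=
          Finset.sum_le_sum fun i _ => by have := h i; omega
        simp only [Finset.sum_const, Finset.card_univ, smul_eq_mul] at h3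
        rw [h1, List.length_map, hl] at h3
        omega
      have hmem := prod_mul_mem_lowerWords μ
        (blockProd_mem_lowerWords h2 c haa hswap hbab i l hi)
      have hbot : lowerWords K a b l.length (l.length + 2 * blockCount l + 2 * μ.length) ≤ ⊥ := by
        refine Submodule.span_le.2 ?_
        rintro _ ⟨ν, r, hr, hw, rfl⟩
        exact ih r.length (hl ▸ hr) ν r rfl (by omega)
      exact hbot hmem
    · by_cases hμ : d < μ.length
      · rw [prod_eq_zero_of_card_lt hbb hb μ hμ, zero_mul]
      have hex : ∃ p ∈ l, d < p.2.length := by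
        by_contra! h
        have h1 : blockCount l ≤ l.length * d := by
          have := List.sum_le_card_nsmul (l.map fun p => p.2.length) d fun x hx => by
            obtain ⟨p, hp, rfl⟩ := List.mem_map.1 hx
            exact h p hp
          simpa [blockCount] using this
        have h3 : l.length * d ≤ 2 * n * d := Nat.mul_le_mul_right _ (by omega)
        have h4 : (2 * n + 1) * d = 2 * n * d + d := by ring
        omega
      obtain ⟨p, hp, hpd⟩ := hex
      have : blockProd a b l = 0 := by
        refine List.prod_eq_zero (List.mem_map.2 ⟨p, hp, ?_⟩)
        rw [prod_eq_zero_of_card_lt hbb hb _ hpd, mul_zero]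
      rw [this, mul_zero]
  refine ⟨M, fun l hl => ?_⟩
  obtain ⟨μ, r, hr, h⟩ : ∃ (μ : List κ) (r : List (ι × List κ)),
      l.length ≤ r.length + 2 * (μ.length + blockCount r) ∧
      (l.map (Sum.elim a b)).prod = (μ.map b).prod * blockProd a b r := by
    clear hl
    induction l with
    | nil => exact ⟨[], [], by simp, by simp⟩
    | cons x l ih =>
      obtain ⟨μ, r, hr, h⟩ := ih
      rcases x with i | k
      · refine ⟨[], (i, μ) :: r, ?_, by simp [h, mul_assoc]⟩
        simp only [List.length_cons, blockCount_cons]; omega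
      · refine ⟨k :: μ, r, ?_, by simp [h, mul_assoc]⟩
        simp only [List.length_cons]; omega
  rw [h]
  exact key _ μ r rfl (hl.trans hr)

end Words

section NilOperators

variable {K P : Type*} [Field K] [AddCommGroup P] [Module K P]

/-- The subspace spanned by the values `T x` with `T ∈ D` and `x ∈ J`. -/
def opSpan (D : Submodule K (Module.End K P)) (J : Submodule K P) : Submodule K P :=
  Submodule.span K {y | ∃ T ∈ D, ∃ x ∈ J, y = T x}

lemma apply_mem_opSpan {D : Submodule K (Module.End K P)} {J : Submodule K P}
    {T : Module.End K P} {x : P} (hT : T ∈ D) (hx : x ∈ J) : T x ∈ opSpan D J :=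
  Submodule.subset_span ⟨T, hT, x, hx, rfl⟩

lemma opSpan_le_iff {D : Submodule K (Module.End K P)} {J S : Submodule K P} :
    opSpan D J ≤ S ↔ ∀ T ∈ D, ∀ x ∈ J, T x ∈ S := by
  refine ⟨fun h T hT x hx => h (apply_mem_opSpan hT hx), fun h => Submodule.span_le.2 ?_⟩
  rintro _ ⟨T, hT, x, hx, rfl⟩
  exact h T hT x hx

lemma opSpan_mono {D D' : Submodule K (Module.End K P)} {J J' : Submodule K P} (hD : D ≤ D')
    (hJ : J ≤ J') : opSpan D J ≤ opSpan D' J' :=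
  opSpan_le_iff.2 fun _ hT _ hx => apply_mem_opSpan (hD hT) (hJ hx)

lemma opSpan_mul (D D' : Submodule K (Module.End K P)) (J : Submodule K P) :
    opSpan (D * D') J = opSpan D (opSpan D' J) := by
  refine le_antisymm (opSpan_le_iff.2 fun T hT x hx => ?_) (opSpan_le_iff.2 fun T hT x hx => ?_)
  · refine Submodule.mul_induction_on hT
      (fun T hT T' hT' => apply_mem_opSpan (J := opSpan D' J) hT (apply_mem_opSpan hT' hx) :)
      fun T T' h h' => add_mem h h'
  · induction hx using Submodule.span_induction with
    | mem y hy =>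
      obtain ⟨T', hT', x, hx, rfl⟩ := hy
      exact apply_mem_opSpan (T := T * T') (Submodule.mul_mem_mul hT hT') hx
    | zero => simp
    | add y z _ _ hy hz => rw [map_add]; exact add_mem hy hz
    | smul c y _ hy => rw [map_smul]; exact Submodule.smul_mem _ _ hy

/-- The subspace generated by `H` and `x` under `D`, provided that `H` is `D`-stable and `D` is
closed under multiplication. -/
def adjoinVec (D : Submodule K (Module.End K P)) (H : Submodule K P) (x : P) : Submodule K P :=
  H ⊔ (K ∙ x ⊔ D.map (LinearMap.applyₗ x))

lemma opSpan_adjoinVec_le {D : Submodule K (Module.End K P)} (hD : D * D ≤ D)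
    {H : Submodule K P} (hH : opSpan D H ≤ H) (x : P) :
    opSpan D (adjoinVec D H x) ≤ H ⊔ D.map (LinearMap.applyₗ x) := by
  refine opSpan_le_iff.2 fun T hT y hy => ?_
  obtain ⟨h, hh, z, hz, rfl⟩ := Submodule.mem_sup.1 hy
  obtain ⟨w, hw, z, ⟨T', hT', rfl⟩, rfl⟩ := Submodule.mem_sup.1 hz
  obtain ⟨c, rfl⟩ := Submodule.mem_span_singleton.1 hw
  rw [map_add, map_add, map_smul]
  refine add_mem (Submodule.mem_sup_left (opSpan_le_iff.1 hH T hT h hh))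
    (Submodule.mem_sup_right (add_mem ?_ ?_))
  · exact Submodule.smul_mem _ _ ⟨T, hT, rfl⟩
  · exact ⟨T * T', hD (Submodule.mul_mem_mul hT hT'), rfl⟩

lemma mem_of_mem_sup_map {D : Submodule K (Module.End K P)} (hnil : ∀ T ∈ D, IsNilpotent T)
    {H : Submodule K P} (hH : opSpan D H ≤ H) {x : P}
    (hx : x ∈ H ⊔ D.map (LinearMap.applyₗ x)) : x ∈ H := by
  obtain ⟨h, hh, _, ⟨T, hT, rfl⟩, hsum⟩ := Submodule.mem_sup.1 hx
  have hsum' : h + T x = x := hsum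
  obtain ⟨n, hn⟩ := hnil T hT
  have key : ∀ k : ℕ, x - (T ^ k) x ∈ H := by
    intro k
    induction k with
    | zero => simp
    | succ k ih =>
      have h1 : x - (T ^ (k + 1)) x = h + T (x - (T ^ k) x) := by
        rw [map_sub, pow_succ', Module.End.mul_apply]
        nth_rewrite 1 [← hsum']
        abel
      rw [h1]
      exact add_mem hh (opSpan_le_iff.1 hH T hT _ ih)
  simpa [hn] using key n

lemma eq_bot_of_le_opSpan_of_acc {D : Submodule K (Module.End K P)} (hD : D * D ≤ D)
    (hnil : ∀ T ∈ D, IsNilpotent T)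
    (hacc : WellFoundedGT {S : Submodule K P // opSpan D S ≤ S})
    {J : Submodule K P} (hJs : opSpan D J ≤ J) (hJ : J ≤ opSpan D J) : J = ⊥ := by
  by_contra hne
  obtain ⟨⟨H, hH⟩, hHJ, hmax⟩ := hacc.wf.has_min
    {S : {S : Submodule K P // opSpan D S ≤ S} | S.1 < J}
    ⟨⟨⊥, opSpan_le_iff.2 fun T _ x hx => by simp [(Submodule.mem_bot K).1 hx]⟩,
      bot_lt_iff_ne_bot.2 hne⟩
  replace hHJ : H < J := hHJ
  obtain ⟨x, hxJ, hxH⟩ := SetLike.exists_of_lt hHJ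
  have hle : adjoinVec D H x ≤ J := by
    refine sup_le hHJ.le (sup_le ((Submodule.span_singleton_le_iff_mem _ _).2 hxJ) ?_)
    rintro _ ⟨T, hT, rfl⟩
    exact opSpan_le_iff.1 hJs T hT x hxJ
  have hsub := opSpan_adjoinVec_le hD hH x
  have hst : opSpan D (adjoinVec D H x) ≤ adjoinVec D H x :=
    hsub.trans (sup_le_sup_left le_sup_right _)
  have hxmem : x ∈ adjoinVec D H x :=
    Submodule.mem_sup_right (Submodule.mem_sup_left (Submodule.mem_span_singleton_self x))
  have hEq : adjoinVec D H x = J := by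
    by_contra h
    refine hmax ⟨_, hst⟩ (lt_of_le_of_ne hle h) ?_
    refine show H < adjoinVec D H x from lt_of_le_of_ne le_sup_left fun h' => hxH ?_
    rw [h']; exact hxmem
  rw [← hEq] at hJ
  exact hxH (mem_of_mem_sup_map hnil hH (hsub (hJ hxmem)))

lemma pow_le_pow_succ_of_le_sup {C D : Submodule K (Module.End K P)} (hC : C ≤ D)
    (h : D ≤ C ⊔ D * D) {n : ℕ} (hn : C ^ n = ⊥) : D ^ n ≤ D ^ (n + 1) := by
  have key : ∀ k : ℕ, D ^ k ≤ C ^ k ⊔ D ^ (k + 1) := by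
    intro k
    induction k with
    | zero => simp
    | succ k ih =>
      have hCk : C ^ k ≤ D ^ k := pow_le_pow_left' hC k
      calc D ^ (k + 1) = D ^ k * D := pow_succ D k
        _ ≤ (C ^ k ⊔ D ^ (k + 1)) * D := mul_le_mul' ih le_rfl
        _ = C ^ k * D ⊔ D ^ (k + 1 + 1) := by rw [Submodule.sup_mul, pow_succ D (k + 1)]
        _ ≤ C ^ k * (C ⊔ D * D) ⊔ D ^ (k + 1 + 1) :=
          sup_le_sup_right (mul_le_mul' le_rfl h) _
        _ = (C ^ (k + 1) ⊔ C ^ k * (D * D)) ⊔ D ^ (k + 1 + 1) := by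
          rw [Submodule.mul_sup, pow_succ C k]
        _ ≤ C ^ (k + 1) ⊔ D ^ (k + 1 + 1) := by
          refine sup_le (sup_le le_sup_left (le_sup_of_le_right ?_)) le_sup_right
          rw [pow_succ, pow_succ, mul_assoc]
          exact mul_le_mul' hCk le_rfl
  simpa [hn] using key n

lemma eq_bot_of_le_opSpan_of_dcc {D C : Submodule K (Module.End K P)} (hD : D * D ≤ D)
    (hnil : ∀ T ∈ D, IsNilpotent T)
    (hC : C ≤ D) (hDC : D ≤ C ⊔ D * D) {n : ℕ} (hn : C ^ n = ⊥)
    (hdcc : WellFoundedLT {S : Submodule K P // opSpan D S ≤ S})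
    {J : Submodule K P} (hJs : opSpan D J ≤ J) (hJ : J ≤ opSpan D J) : J = ⊥ := by
  have hn' : C ^ (n + 1) = ⊥ := by rw [pow_succ, hn, Submodule.bot_mul]
  set Q := D ^ (n + 1) with hQ
  have hstep := pow_le_pow_succ_of_le_sup hC hDC hn'
  have hQD : Q ≤ Q * D := by rw [hQ, ← pow_succ]; exact hstep
  have hQle : ∀ k, Q ≤ Q * D ^ k := by
    intro k
    induction k with
    | zero => simp
    | succ k ih =>
      calc Q ≤ Q * D := hQD
        _ ≤ Q * D ^ k * D := mul_le_mul' ih le_rfl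
        _ = _ := by rw [pow_succ, mul_assoc]
  have hQQ : Q ≤ Q * Q := hQle (n + 1)
  have hpow : ∀ k : ℕ, D ^ (k + 1) ≤ D := by
    intro k
    induction k with
    | zero => simp
    | succ k ih =>
      rw [pow_succ]
      exact (mul_le_mul' ih le_rfl).trans hD
  have hQDle : Q ≤ D := hpow n
  have hQmul : Q * D ≤ Q := by
    rw [hQ, pow_succ, mul_assoc]
    exact mul_le_mul' le_rfl hD
  have hJpow : ∀ k, J ≤ opSpan (D ^ k) J := by
    intro k
    induction k with
    | zero =>
      intro x hx
      exact apply_mem_opSpan (T := 1) (by rw [pow_zero]; exact Submodule.one_le.1 le_rfl) hx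
    | succ k ih =>
      rw [pow_succ, opSpan_mul]
      exact ih.trans (opSpan_mono le_rfl hJ)
  let H : Submodule K P :=
    { carrier := {x | x ∈ J ∧ ∀ T ∈ Q, T x = 0}
      add_mem' := fun {x y} hx hy =>
        ⟨add_mem hx.1 hy.1, fun T hT => by rw [map_add, hx.2 T hT, hy.2 T hT, add_zero]⟩
      zero_mem' := ⟨zero_mem _, fun T _ => map_zero T⟩
      smul_mem' := fun c x hx =>
        ⟨Submodule.smul_mem _ _ hx.1, fun T hT => by rw [map_smul, hx.2 T hT, smul_zero]⟩ }
  have hHJ : H ≤ J := fun x hx => hx.1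
  have hHs : opSpan D H ≤ H := opSpan_le_iff.2 fun T hT x hx =>
    ⟨opSpan_le_iff.1 hJs T hT x hx.1, fun T' hT' =>
      hx.2 (T' * T) (hQmul (Submodule.mul_mem_mul hT' hT))⟩
  have hkill : ∀ S : Submodule K P, S ≤ J → opSpan Q S ≤ H → S ≤ H := by
    intro S hS hSH x hx
    refine ⟨hS hx, fun T hT => ?_⟩
    have h1 : T x ∈ opSpan Q (opSpan Q S) := by
      rw [← opSpan_mul]; exact apply_mem_opSpan (hQQ hT) hx
    have h3 : opSpan Q (opSpan Q S) ≤ ⊥ := opSpan_le_iff.2 fun T hT y hy => (hSH hy).2 T hT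
    exact h3 h1
  have hHeq : H = J := by
    by_contra hne
    obtain ⟨⟨S, hS⟩, ⟨hHS, hSJ⟩, hmin⟩ := hdcc.wf.has_min
      {S : {S : Submodule K P // opSpan D S ≤ S} | H < S.1 ∧ S.1 ≤ J}
      ⟨⟨J, hJs⟩, lt_of_le_of_ne hHJ hne, le_rfl⟩
    dsimp only at hHS hSJ
    obtain ⟨x, hxS, hxH⟩ := SetLike.exists_of_lt hHS
    have hminEq : ∀ X : Submodule K P, opSpan D X ≤ X → H ≤ X → X ≤ S → x ∈ X → X = S := by
      intro X hX hHX hXS hxX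
      by_contra h
      refine hmin ⟨X, hX⟩ ⟨lt_of_le_of_ne hHX ?_, hXS.trans hSJ⟩ (show X < S from lt_of_le_of_ne hXS h)
      rintro rfl
      exact hxH hxX
    have hsub := opSpan_adjoinVec_le hD hHs x
    have hxmem : x ∈ adjoinVec D H x :=
      Submodule.mem_sup_right (Submodule.mem_sup_left (Submodule.mem_span_singleton_self x))
    have hSeq : adjoinVec D H x = S := by
      refine hminEq _ (hsub.trans (sup_le_sup_left le_sup_right _)) le_sup_left ?_ hxmem
      refine sup_le hHS.le (sup_le ((Submodule.span_singleton_le_iff_mem _ _).2 hxS) ?_)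
      rintro _ ⟨T, hT, rfl⟩
      exact opSpan_le_iff.1 hS T hT x hxS
    have hDS : opSpan D S ≤ H := by
      by_contra hnot
      have hX : opSpan D (H ⊔ opSpan D S) ≤ H ⊔ opSpan D S :=
        (opSpan_mono le_rfl (sup_le hHS.le hS)).trans le_sup_right
      have hXS : H ⊔ opSpan D S = S := by
        by_contra h
        refine hmin ⟨_, hX⟩ ⟨lt_of_le_of_ne le_sup_left fun h' => hnot ?_,
          (sup_le hHS.le hS).trans hSJ⟩ 
          (show H ⊔ opSpan D S < S from lt_of_le_of_ne (sup_le hHS.le hS) h)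
        exact sup_eq_left.1 h'.symm
      have hx' : x ∈ H ⊔ opSpan D S := by rw [hXS]; exact hxS
      rw [← hSeq] at hx'
      exact hxH (mem_of_mem_sup_map hnil hHs ((sup_le le_sup_left hsub) hx'))
    exact absurd (hkill S hSJ ((opSpan_mono hQDle le_rfl).trans hDS)) hHS.not_ge
  have : J ≤ ⊥ := (hJpow (n + 1)).trans (opSpan_le_iff.2 fun T hT x hx => by
    rw [← hHeq] at hx
    exact hx.2 T hT)
  exact le_bot_iff.1 this

end NilOperators

section BilinearSystem

variable {K P Q : Type*} [Field K] [AddCommGroup P] [Module K P] [AddCommGroup Q] [Module K Q]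

/-- A pair of spaces `P`, `Q` with an action `m` of `Q` on `P` and a symmetric bilinear map
`f : P × P → Q`, satisfying the identities that hold between the Peirce components of a Bernstein
algebra modulo the annihilator of `U`. -/
structure IsPeircePair (m : Q →ₗ[K] P →ₗ[K] P) (f : P →ₗ[K] P →ₗ[K] Q) : Prop where
  symm : ∀ x y, f x y = f y x
  act_act : ∀ v x, m v (m v x) = 0
  form_act : ∀ v x, f x (m v x) = 0
  cube : ∀ x, m (f x x) x = 0

namespace IsPeircePair

variable {m : Q →ₗ[K] P →ₗ[K] P} {f : P →ₗ[K] P →ₗ[K] Q}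

lemma act_comm (h : IsPeircePair m f) (v w : Q) (x : P) : m v (m w x) = -m w (m v x) := by
  have := h.act_act (v + w) x
  simp only [map_add, LinearMap.add_apply, h.act_act, zero_add, add_zero] at this
  rw [add_comm] at this
  exact eq_neg_of_add_eq_zero_left (by rw [← this]; try abel)

lemma form_act_comm (h : IsPeircePair m f) (v : Q) (x y : P) : f x (m v y) = -f y (m v x) := by
  have := h.form_act v (x + y)
  simp only [map_add, LinearMap.add_apply, h.form_act, zero_add, add_zero] at this
  exact eq_neg_of_add_eq_zero_left (by rw [← this]; try abel)

lemma cyclic (h : IsPeircePair m f) (h2 : (2 : K) ≠ 0) (x y z : P) :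
    m (f x y) z + m (f y z) x + m (f z x) y = 0 := by
  have h1 : ∀ x y : P, (2 : K) • m (f x y) x + m (f x x) y = 0 := by
    intro x y
    have ha := h.cube (x + y)
    have hb := h.cube (x - y)
    simp only [map_add, map_sub, LinearMap.add_apply, LinearMap.sub_apply, h.cube, h.symm y x]
      at ha hb
    have hy := h.cube y
    have := congrArg ((2 : K)⁻¹ • ·) (show (2 : K) • ((2 : K) • m (f x y) x + m (f x x) y) = 0 by
      linear_combination (norm := module) ha - hb)
    simpa [inv_smul_smul₀ h2] using this
  have ha := h1 (x + z) y
  have hx := h1 x y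
  have hz := h1 z y
  simp only [map_add, LinearMap.add_apply, h.symm z x] at ha
  have := congrArg ((2 : K)⁻¹ • ·) (show (2 : K) •
      (m (f x y) z + m (f y z) x + m (f z x) y) = 0 by
    rw [h.symm y z, h.symm z x]
    linear_combination (norm := module) ha - hx - hz)
  simpa [inv_smul_smul₀ h2] using this

end IsPeircePair

/-- The operator `x ↦ (x u) u'` on `P`. -/
def doubleOp (m : Q →ₗ[K] P →ₗ[K] P) (f : P →ₗ[K] P →ₗ[K] Q) (u u' : P) : Module.End K P :=
  (m.flip u').comp (f.flip u)

@[simp] lemma doubleOp_apply (m : Q →ₗ[K] P →ₗ[K] P) (f : P →ₗ[K] P →ₗ[K] Q) (u u' x : P) :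
    doubleOp m f u u' x = m (f x u) u' := rfl

/-- The operators on `P` attached to the letters `Q ⊕ P × P`. -/
def letterOp (m : Q →ₗ[K] P →ₗ[K] P) (f : P →ₗ[K] P →ₗ[K] Q) : Q ⊕ P × P → Module.End K P :=
  Sum.elim (fun v => m v) fun p => doubleOp m f p.1 p.2

/-- The multiplication by `u ∈ P` on `P × Q`. -/
def mulP (m : Q →ₗ[K] P →ₗ[K] P) (f : P →ₗ[K] P →ₗ[K] Q) (u : P) : Module.End K (P × Q) :=
  ((m.flip u).comp (LinearMap.snd K P Q)).prod ((f.flip u).comp (LinearMap.fst K P Q))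

/-- The multiplication by `v ∈ Q` on `P × Q`. -/
def mulQ (m : Q →ₗ[K] P →ₗ[K] P) (v : Q) : Module.End K (P × Q) :=
  ((m v).comp (LinearMap.fst K P Q)).prod 0

@[simp] lemma mulP_apply (m : Q →ₗ[K] P →ₗ[K] P) (f : P →ₗ[K] P →ₗ[K] Q) (u : P) (z : P × Q) :
    mulP m f u z = (m z.2 u, f z.1 u) := rfl

@[simp] lemma mulQ_apply (m : Q →ₗ[K] P →ₗ[K] P) (v : Q) (z : P × Q) :
    mulQ m v z = (m v z.1, 0) := rfl

namespace IsPeircePair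

variable {m : Q →ₗ[K] P →ₗ[K] P} {f : P →ₗ[K] P →ₗ[K] Q}

lemma prod_act_comm (h : IsPeircePair m f) (v : Q) (μ : List Q) (x : P) :
    (μ.map fun v => (m v : Module.End K P)).prod (m v x) =
      (-1 : K) ^ μ.length • m v ((μ.map fun v => (m v : Module.End K P)).prod x) := by
  induction μ with
  | nil => simp
  | cons w μ ih =>
    simp only [List.map_cons, List.prod_cons, Module.End.mul_apply, ih, map_smul,
      List.length_cons, pow_succ]
    rw [h.act_comm w v]
    simp

lemma exists_sign (h : IsPeircePair m f) (k : ℕ) : ∃ s : K, (s = 1 ∨ s = -1) ∧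
    ∀ (μ : List Q) (x y : P), μ.length = k →
      f ((μ.map fun v => (m v : Module.End K P)).prod x) y =
        s • f ((μ.map fun v => (m v : Module.End K P)).prod y) x := by
  induction k with
  | zero =>
    refine ⟨1, Or.inl rfl, fun μ x y hμ => ?_⟩
    rw [List.length_eq_zero_iff.1 hμ]
    simpa using h.symm x y
  | succ k ih =>
    obtain ⟨s, hs, hsk⟩ := ih
    refine ⟨-(s * (-1) ^ k), ?_, fun μ x y hμ => ?_⟩
    · rcases hs with rfl | rfl <;> rcases neg_one_pow_eq_or K k with hk | hk <;> simp [hk]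
    · obtain _ | ⟨v, μ⟩ := μ
      · simp at hμ
      have hμ' : μ.length = k := by simpa using hμ
      simp only [List.map_cons, List.prod_cons, Module.End.mul_apply]
      rw [h.symm, h.form_act_comm, hsk μ x _ hμ', h.prod_act_comm, hμ']
      simp [mul_smul]

lemma mulQ_prod_apply (μ : List Q) (hμ : μ ≠ []) (z : P × Q) :
    (μ.map (mulQ m)).prod z = ((μ.map fun v => (m v : Module.End K P)).prod z.1, 0) := by
  induction μ with
  | nil => exact absurd rfl hμ
  | cons v μ ih =>
    rcases eq_or_ne μ [] with rfl | h
    · simp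
    · simp [ih h]

/-- Operators on `P` from a finite set of letters have vanishing products of large length. -/
theorem exists_forall_letterOp_prod_eq_zero (h : IsPeircePair m f) (h2 : (2 : K) ≠ 0)
    (S : Finset (Q ⊕ P × P)) :
    ∃ M : ℕ, ∀ l : List (Q ⊕ P × P), (∀ x ∈ l, x ∈ S) → M ≤ l.length →
      (l.map (letterOp m f)).prod = 0 := by
  classical
  let A : Finset P := S.biUnion (Sum.elim (fun _ => ∅) fun p => {p.1, p.2})
  let B : Finset Q := S.biUnion (Sum.elim (fun v => {v}) fun _ => ∅) ∪
    (A ×ˢ A).image fun p => f p.1 p.2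
  let a : A → Module.End K (P × Q) := fun u => mulP m f u
  let b : B → Module.End K (P × Q) := fun v => mulQ m v
  let c : A → A → B := fun u u' => ⟨f u u', Finset.mem_union_right _
    (Finset.mem_image.2 ⟨(u.1, u'.1), Finset.mem_product.2 ⟨u.2, u'.2⟩, rfl⟩)⟩
  obtain ⟨M, hM⟩ := exists_forall_prod_eq_zero (K := K) (a := a) (b := b) h2 c
    (fun v w => LinearMap.ext fun z => by simp [b, h.act_comm v.1 w.1])
    (fun v => LinearMap.ext fun z => by simp [b, h.act_act])
    (fun u u' => LinearMap.ext fun z => by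
      have h1 := h.cyclic h2 z.1 u u'
      have h3 := h.form_act_comm z.2 u u'
      rw [h.symm u' z.1] at h1
      rw [h.symm u, h.symm u'] at h3
      refine Prod.ext ?_ ?_
      · simp only [a, b, c, LinearMap.add_apply, LinearMap.neg_apply, Module.End.mul_apply,
          mulP_apply, mulQ_apply, Prod.fst_add, Prod.fst_neg]
        linear_combination (norm := module) h1
      · simp [a, b, c, h3])
    (fun u u' μ hμ => by
      let lop : List Q → Module.End K P := fun l => (l.map fun v => (m v : Module.End K P)).prod
      have hz : ∀ (u u' : A) (z : P × Q), (a u * (μ.map b).prod * a u') z =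
          (0, f (lop (μ.map Subtype.val ++ [z.2]) u') u) := by
        intro u u' z
        have h3 := mulQ_prod_apply (m := m) (μ.map Subtype.val) 
          (fun h0 => hμ (List.map_eq_nil_iff.1 h0)) (mulP m f u' z)
        rw [List.map_map] at h3
        change mulP m f u ((μ.map b).prod (mulP m f u' z)) = _
        rw [show μ.map b = μ.map (mulQ m ∘ Subtype.val) from rfl, h3]
        simp [lop]
      obtain ⟨s, hs, hsμ⟩ := h.exists_sign (μ.length + 1)
      have hzs : ∀ z, (a u * (μ.map b).prod * a u') z = s • (a u' * (μ.map b).prod * a u) z := by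
        intro z
        rw [hz, hz, hsμ _ _ _ (by simp), Prod.smul_mk, smul_zero]
      rcases hs with rfl | rfl
      · exact Or.inl (LinearMap.ext fun z => by simpa using hzs z)
      · exact Or.inr (LinearMap.ext fun z => by simpa using hzs z))
    (fun v u w => LinearMap.ext fun z => by simp [a, b])
  refine ⟨M, fun l hl hlen => ?_⟩
  have hword : ∀ l : List (Q ⊕ P × P), (∀ x ∈ l, x ∈ S) → ∃ r : List (A ⊕ B),
      l.length ≤ r.length ∧
      ∀ x, (r.map (Sum.elim a b)).prod (x, 0) = ((l.map (letterOp m f)).prod x, 0) := by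
    intro l
    induction l with
    | nil => exact fun _ => ⟨[], le_rfl, fun x => rfl⟩
    | cons t l ih =>
      intro hl
      obtain ⟨r, hr, hrl⟩ := ih fun x hx => hl x (List.mem_cons_of_mem _ hx)
      have ht : t ∈ S := hl t List.mem_cons_self
      rcases t with v | ⟨u, u'⟩
      · have hv : v ∈ B := Finset.mem_union_left _
          (Finset.mem_biUnion.2 ⟨_, ht, Finset.mem_singleton_self v⟩)
        exact ⟨Sum.inr ⟨v, hv⟩ :: r, by simpa using hr, fun x => by simp [hrl, b, letterOp]⟩
      · have hu : u ∈ A := Finset.mem_biUnion.2 ⟨_, ht, by simp⟩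
        have hu' : u' ∈ A := Finset.mem_biUnion.2 ⟨_, ht, by simp⟩
        refine ⟨Sum.inl ⟨u', hu'⟩ :: Sum.inl ⟨u, hu⟩ :: r, ?_, fun x => ?_⟩
        · simp only [List.length_cons]; omega
        · simp [hrl, a, letterOp]
  obtain ⟨r, hr, hrl⟩ := hword l hl
  refine LinearMap.ext fun x => ?_
  have := hrl x
  rw [hM r (hlen.trans hr)] at this
  exact (congrArg Prod.fst this).symm

end IsPeircePair

end BilinearSystem

section WordSpan

variable {K R ι : Type*} [Field K] [Ring R] [Algebra K R]

/-- The span of the products of at least `k` values of `g` at letters from `S`. -/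
def wordSpan (K : Type*) {R ι : Type*} [Field K] [Ring R] [Algebra K R] (g : ι → R) (S : Set ι)
    (k : ℕ) : Submodule K R :=
  Submodule.span K {T | ∃ l : List ι, (∀ i ∈ l, i ∈ S) ∧ k ≤ l.length ∧ (l.map g).prod = T}

variable {g : ι → R}

lemma prod_mem_wordSpan {S : Set ι} {k : ℕ} (l : List ι) (hl : ∀ i ∈ l, i ∈ S)
    (hk : k ≤ l.length) : (l.map g).prod ∈ wordSpan K g S k :=
  Submodule.subset_span ⟨l, hl, hk, rfl⟩

lemma mem_wordSpan_one {S : Set ι} {i : ι} (hi : i ∈ S) : g i ∈ wordSpan K g S 1 := by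
  simpa using prod_mem_wordSpan (K := K) (g := g) [i] (by simpa using hi) le_rfl

lemma wordSpan_mono {S S' : Set ι} {k k' : ℕ} (hS : S ⊆ S') (hk : k' ≤ k) :
    wordSpan K g S k ≤ wordSpan K g S' k' := by
  refine Submodule.span_le.2 ?_
  rintro _ ⟨l, hl, hlk, rfl⟩
  exact prod_mem_wordSpan l (fun i hi => hS (hl i hi)) (hk.trans hlk)

lemma wordSpan_mul_le (S : Set ι) (j k : ℕ) :
    wordSpan K g S j * wordSpan K g S k ≤ wordSpan K g S (j + k) := by
  rw [wordSpan, wordSpan, Submodule.span_mul_span, Submodule.span_le]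
  rintro _ ⟨_, ⟨l, hl, hlj, rfl⟩, _, ⟨l', hl', hlk, rfl⟩, rfl⟩
  simp only [← List.prod_append, ← List.map_append]
  refine prod_mem_wordSpan _ (fun i hi => ?_) (by rw [List.length_append]; omega)
  exact (List.mem_append.1 hi).elim (hl i) (hl' i)

lemma wordSpan_one_pow_le (S : Set ι) (k : ℕ) :
    wordSpan K g S 1 ^ k ≤ wordSpan K g S k := by
  induction k with
  | zero =>
    rw [pow_zero, Submodule.one_le]
    exact prod_mem_wordSpan [] (by simp) le_rfl
  | succ k ih => exact (pow_succ _ k).trans_le ((mul_le_mul' ih le_rfl).trans (wordSpan_mul_le S k 1))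

lemma exists_finset_mem_wordSpan {k : ℕ} {T : R} (hT : T ∈ wordSpan K g Set.univ k) :
    ∃ F : Finset ι, T ∈ wordSpan K g (F : Set ι) k := by
  classical
  induction hT using Submodule.span_induction with
  | mem T hT =>
    obtain ⟨l, -, hk, rfl⟩ := hT
    exact ⟨l.toFinset, prod_mem_wordSpan l (by simp) hk⟩
  | zero => exact ⟨∅, zero_mem _⟩
  | add x y _ _ hx hy =>
    obtain ⟨F, hF⟩ := hx
    obtain ⟨G, hG⟩ := hy
    exact ⟨F ∪ G, add_mem (wordSpan_mono (by simp) le_rfl hF) (wordSpan_mono (by simp) le_rfl hG)⟩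
  | smul c x _ hx =>
    obtain ⟨F, hF⟩ := hx
    exact ⟨F, Submodule.smul_mem _ c hF⟩

lemma wordSpan_eq_bot {S : Set ι} {k : ℕ}
    (h : ∀ l : List ι, (∀ i ∈ l, i ∈ S) → k ≤ l.length → (l.map g).prod = 0) :
    wordSpan K g S k = ⊥ := by
  refine Submodule.span_eq_bot.2 ?_
  rintro _ ⟨l, hl, hk, rfl⟩
  exact h l hl hk

lemma isNilpotent_of_mem_wordSpan
    (h : ∀ F : Finset ι, ∃ k, ∀ l : List ι, (∀ i ∈ l, i ∈ F) → k ≤ l.length → (l.map g).prod = 0)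
    {T : R} (hT : T ∈ wordSpan K g Set.univ 1) : IsNilpotent T := by
  obtain ⟨F, hF⟩ := exists_finset_mem_wordSpan hT
  obtain ⟨k, hk⟩ := h F
  refine ⟨k, (Submodule.mem_bot K).1 ?_⟩
  rw [← wordSpan_eq_bot (K := K) (S := (F : Set ι)) hk]
  exact wordSpan_one_pow_le _ _ (Submodule.pow_mem_pow _ hF k)

lemma wordSpan_univ_mul_le :
    wordSpan K g Set.univ 1 * wordSpan K g Set.univ 1 ≤ wordSpan K g Set.univ 1 :=
  (wordSpan_mul_le _ _ _).trans (wordSpan_mono subset_rfl (by omega))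

lemma wordSpan_univ_le {E : Submodule K R}
    (h : wordSpan K g Set.univ 1 * wordSpan K g Set.univ 1 ≤ E) (hg : ∀ i, g i ∈ E) :
    wordSpan K g Set.univ 1 ≤ E := by
  refine Submodule.span_le.2 ?_
  rintro _ ⟨_ | ⟨i, _ | ⟨j, l⟩⟩, -, hk, rfl⟩
  · simp at hk
  · simpa using hg i
  · rw [List.map_cons, List.prod_cons]
    exact h (Submodule.mul_mem_mul (mem_wordSpan_one (Set.mem_univ i))
      (prod_mem_wordSpan _ (fun _ _ => Set.mem_univ _) (by simp)))

end WordSpan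

section FiniteGeneration

variable {K M : Type*} [Field K] [AddCommGroup M] [Module K M]

lemma exists_finset_span_sup_eq_top (R : Submodule K M) [WellFoundedLT (Set.Ici R)] :
    ∃ F : Finset M, Submodule.span K (F : Set M) ⊔ R = ⊤ := by
  classical
  have : IsArtinian K (M ⧸ R) :=
    (Submodule.comapMkQRelIso R).strictMono.wellFoundedLT
  have : Module.Finite K (M ⧸ R) := (IsSemisimpleModule.finite_tfae.out 2 0).1 this
  obtain ⟨n, s, hs⟩ := Module.Finite.exists_fin (R := K) (M := M ⧸ R)
  choose t ht using fun i => R.mkQ_surjective (s i)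
  refine ⟨Finset.univ.image t, ?_⟩
  rw [sup_comm, ← Submodule.map_mkQ_eq_top, Submodule.map_span, ← hs]
  rw [Finset.coe_image, Finset.coe_univ, Set.image_univ, ← Set.range_comp]
  exact congrArg (fun s => Submodule.span K (Set.range s)) (funext ht)

end FiniteGeneration

section StablePairs

variable {K P Q : Type*} [Field K] [AddCommGroup P] [Module K P] [AddCommGroup Q] [Module K Q]

/-- The pairs of subspaces `S ⊆ P`, `T ⊆ Q` that correspond to ideals. -/
structure IsStable (m : Q →ₗ[K] P →ₗ[K] P) (f : P →ₗ[K] P →ₗ[K] Q)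
    (Z : Submodule K P × Submodule K Q) : Prop where
  act_mem : ∀ v, ∀ x ∈ Z.1, m v x ∈ Z.1
  mem_act : ∀ v ∈ Z.2, ∀ x, m v x ∈ Z.1
  form_mem : ∀ x ∈ Z.1, ∀ y, f x y ∈ Z.2

variable {m : Q →ₗ[K] P →ₗ[K] P} {f : P →ₗ[K] P →ₗ[K] Q}

/-- The operators on `P` generated by the action of `Q` and the maps `x ↦ (x u) u'`. -/
def opAlg (m : Q →ₗ[K] P →ₗ[K] P) (f : P →ₗ[K] P →ₗ[K] Q) : Submodule K (Module.End K P) :=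
  wordSpan K (letterOp m f) Set.univ 1

lemma act_mem_opAlg (v : Q) : m v ∈ opAlg m f :=
  mem_wordSpan_one (g := letterOp m f) (Set.mem_univ (Sum.inl v))

lemma doubleOp_mem_opAlg (u u' : P) : doubleOp m f u u' ∈ opAlg m f :=
  mem_wordSpan_one (g := letterOp m f) (Set.mem_univ (Sum.inr (u, u')))

lemma isStable_of_opSpan_le {S : Submodule K P} (hS : opSpan (opAlg m f) S ≤ S) :
    IsStable m f (S, Submodule.map₂ f S ⊤) where
  act_mem v x hx := opSpan_le_iff.1 hS _ (act_mem_opAlg v) x hx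
  mem_act v hv y := by
    have : Submodule.map₂ f S ⊤ ≤ S.comap (m.flip y) := Submodule.map₂_le.2 fun x hx z _ =>
      opSpan_le_iff.1 hS _ (doubleOp_mem_opAlg z y) x hx
    exact this hv
  form_mem x hx y := Submodule.apply_mem_map₂ f hx Submodule.mem_top

lemma strictMono_stablePair : StrictMono fun S : {S : Submodule K P // opSpan (opAlg m f) S ≤ S} =>
    (⟨(S.1, Submodule.map₂ f S.1 ⊤), isStable_of_opSpan_le S.2⟩ : {Z // IsStable m f Z}) :=
  Monotone.strictMono_of_injective (fun _ _ h => ⟨h, Submodule.map₂_le_map₂_left h⟩)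
    fun _ _ h => Subtype.ext (congrArg (fun Z : {Z // IsStable m f Z} => Z.1.1) h)

lemma exists_finset_span_sup_act [WellFoundedLT {Z // IsStable m f Z}] :
    ∃ F : Finset P, Submodule.span K (F : Set P) ⊔ Submodule.map₂ m ⊤ ⊤ = ⊤ := by
  let φ : Set.Ici (Submodule.map₂ m ⊤ ⊤) → {Z // IsStable m f Z} := fun S => ⟨(S.1, ⊤),
    { act_mem := fun _ _ _ => S.2 (Submodule.apply_mem_map₂ m Submodule.mem_top Submodule.mem_top)
      mem_act := fun _ _ _ => S.2 (Submodule.apply_mem_map₂ m Submodule.mem_top Submodule.mem_top)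
      form_mem := fun _ _ _ => Submodule.mem_top }⟩
  have hφ : StrictMono φ := Monotone.strictMono_of_injective (fun _ _ h => ⟨h, le_rfl⟩)
    fun _ _ h => Subtype.ext (congrArg (fun Z : {Z // IsStable m f Z} => Z.1.1) h)
  have := hφ.wellFoundedLT
  exact exists_finset_span_sup_eq_top _

lemma exists_finset_span_sup_form [WellFoundedLT {Z // IsStable m f Z}] :
    ∃ F : Finset Q, Submodule.span K (F : Set Q) ⊔ Submodule.map₂ f ⊤ ⊤ = ⊤ := by
  let φ : Set.Ici (Submodule.map₂ f ⊤ ⊤) → {Z // IsStable m f Z} := fun T => ⟨(⊤, T.1),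
    { act_mem := fun _ _ _ => Submodule.mem_top
      mem_act := fun _ _ _ => Submodule.mem_top
      form_mem := fun _ _ _ =>
        T.2 (Submodule.apply_mem_map₂ f Submodule.mem_top Submodule.mem_top) }⟩
  have hφ : StrictMono φ := Monotone.strictMono_of_injective (fun _ _ h => ⟨le_rfl, h⟩)
    fun _ _ h => Subtype.ext (congrArg (fun Z : {Z // IsStable m f Z} => Z.1.2) h)
  have := hφ.wellFoundedLT
  exact exists_finset_span_sup_eq_top _

/-- A subspace of `P` that is stable under the letters is stable under `opAlg m f`. -/
lemma opSpan_opAlg_le {J : Submodule K P} (hm : ∀ v, ∀ x ∈ J, m v x ∈ J)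
    (hf : ∀ u u', ∀ x ∈ J, m (f x u) u' ∈ J) : opSpan (opAlg m f) J ≤ J := by
  have key : ∀ l : List (Q ⊕ P × P), ∀ x ∈ J, (l.map (letterOp m f)).prod x ∈ J := by
    intro l
    induction l with
    | nil => exact fun x hx => hx
    | cons i l ih =>
      intro x hx
      rcases i with v | ⟨u, u'⟩
      · exact hm _ _ (ih x hx)
      · exact hf _ _ _ (ih x hx)
  refine opSpan_le_iff.2 fun T hT x hx => ?_
  have : opAlg m f ≤ J.comap (LinearMap.applyₗ x) := by
    refine Submodule.span_le.2 ?_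
    rintro _ ⟨l, -, -, rfl⟩
    exact key l x hx
  exact this hT

namespace IsPeircePair

lemma isNilpotent_of_mem_opAlg (h : IsPeircePair m f) (h2 : (2 : K) ≠ 0) {T : Module.End K P}
    (hT : T ∈ opAlg m f) : IsNilpotent T :=
  isNilpotent_of_mem_wordSpan (h.exists_forall_letterOp_prod_eq_zero h2) hT

lemma doubleOp_act_left (h : IsPeircePair m f) (v : Q) (u u' : P) :
    doubleOp m f (m v u) u' = -(doubleOp m f u u' * (m v : Module.End K P)) :=
  LinearMap.ext fun x => by simp [h.form_act_comm v x u, h.symm u]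

lemma doubleOp_act_right (h : IsPeircePair m f) (v : Q) (u u' : P) :
    doubleOp m f u (m v u') = -((m v : Module.End K P) * doubleOp m f u u') :=
  LinearMap.ext fun x => by simp [h.act_comm v (f x u) u']

lemma act_form (h : IsPeircePair m f) (h2 : (2 : K) ≠ 0) (u u' : P) :
    (m (f u u') : Module.End K P) = -(doubleOp m f u u' + doubleOp m f u' u) :=
  LinearMap.ext fun x => by
    have := h.cyclic h2 x u u'
    rw [h.symm u' x] at this
    simp only [LinearMap.neg_apply, LinearMap.add_apply, doubleOp_apply]
    linear_combination (norm := module) this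

/-- Modulo products of two operators, the algebra `opAlg m f` is spanned by finitely many letters
as soon as stable pairs satisfy the descending chain condition. -/
lemma exists_finset_opAlg_le (h : IsPeircePair m f) (h2 : (2 : K) ≠ 0)
    [WellFoundedLT {Z // IsStable m f Z}] :
    ∃ L : Finset (Q ⊕ P × P), opAlg m f ≤
      wordSpan K (letterOp m f) L 1 ⊔ opAlg m f * opAlg m f := by
  classical
  obtain ⟨F, hF⟩ := exists_finset_span_sup_act (m := m) (f := f)
  obtain ⟨G, hG⟩ := exists_finset_span_sup_form (m := m) (f := f)
  let L : Finset (Q ⊕ P × P) := G.image Sum.inl ∪ (F ×ˢ F).image Sum.inr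
  set E := wordSpan K (letterOp m f) L 1 ⊔ opAlg m f * opAlg m f with hE
  have hdd : opAlg m f * opAlg m f ≤ E := le_sup_right
  have hletter : ∀ i ∈ L, letterOp m f i ∈ E := fun i hi =>
    Submodule.mem_sup_left (mem_wordSpan_one hi)
  have hindP : ∀ p : Submodule K P, (∀ u ∈ F, u ∈ p) → (∀ v u, m v u ∈ p) → p = ⊤ := by
    refine fun p hp hp' => eq_top_iff.2 (hF.symm.trans_le (sup_le (Submodule.span_le.2 hp) ?_))
    exact Submodule.map₂_le.2 fun v _ u _ => hp' v u
  have hindQ : ∀ p : Submodule K Q, (∀ v ∈ G, v ∈ p) → (∀ u u', f u u' ∈ p) → p = ⊤ := by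
    refine fun p hp hp' => eq_top_iff.2 (hG.symm.trans_le (sup_le (Submodule.span_le.2 hp) ?_))
    exact Submodule.map₂_le.2 fun v _ u _ => hp' v u
  have hleft : ∀ u u' v, doubleOp m f (m v u) u' ∈ E := fun u u' v => by
    rw [h.doubleOp_act_left]
    exact neg_mem (hdd (Submodule.mul_mem_mul (doubleOp_mem_opAlg _ _) (act_mem_opAlg _)))
  have hright : ∀ u u' v, doubleOp m f u (m v u') ∈ E := fun u u' v => by
    rw [h.doubleOp_act_right]
    exact neg_mem (hdd (Submodule.mul_mem_mul (act_mem_opAlg _) (doubleOp_mem_opAlg _ _)))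
  have hdouble : ∀ u u', doubleOp m f u u' ∈ E := by
    let B : P →ₗ[K] P →ₗ[K] Module.End K P := LinearMap.mk₂ K (doubleOp m f)
      (fun _ _ _ => by ext; simp) (fun _ _ _ => by ext; simp) (fun _ _ _ => by ext; simp)
      (fun _ _ _ => by ext; simp)
    intro u u'
    have h1 : ∀ u ∈ F, E.comap (B u) = ⊤ := fun u hu => hindP _
      (fun u' hu' => hletter (Sum.inr (u, u')) (by simp [L, hu, hu'])) fun v u' => hright u u' v
    have h3 : E.comap (B.flip u') = ⊤ := hindP _
      (fun u hu => Submodule.eq_top_iff'.1 (h1 u hu) u') fun v u => hleft u u' v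
    exact Submodule.eq_top_iff'.1 h3 u
  have hact : ∀ v, (m v : Module.End K P) ∈ E := by
    have h1 : E.comap (m : Q →ₗ[K] Module.End K P) = ⊤ := hindQ _
      (fun v hv => hletter (Sum.inl v) (by simp [L, hv])) fun u u' => by
        rw [Submodule.mem_comap, h.act_form h2]
        exact neg_mem (add_mem (hdouble _ _) (hdouble _ _))
    exact Submodule.eq_top_iff'.1 h1
  refine ⟨L, wordSpan_univ_le hdd ?_⟩
  rintro (v | ⟨u, u'⟩)
  · exact hact v
  · exact hdouble u u'

/-- Under a chain condition on stable pairs, no nonzero subspace is reproduced by the operators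
`m v` and `x ↦ m (f x u) u'`. -/
theorem eq_bot_of_le_opSpan (h : IsPeircePair m f) (h2 : (2 : K) ≠ 0)
    (hchain : WellFoundedGT {Z // IsStable m f Z} ∨ WellFoundedLT {Z // IsStable m f Z})
    {J : Submodule K P} (hJs : opSpan (opAlg m f) J ≤ J) (hJ : J ≤ opSpan (opAlg m f) J) :
    J = ⊥ := by
  have hmul : opAlg m f * opAlg m f ≤ opAlg m f := wordSpan_univ_mul_le
  have hnil : ∀ T ∈ opAlg m f, IsNilpotent T := fun T hT => h.isNilpotent_of_mem_opAlg h2 hT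
  rcases hchain with hchain | hchain
  · have hwf : WellFoundedGT {S : Submodule K P // opSpan (opAlg m f) S ≤ S} :=
      (strictMono_stablePair (m := m) (f := f)).wellFoundedGT
    exact eq_bot_of_le_opSpan_of_acc hmul hnil hwf hJs hJ
  · obtain ⟨L, hL⟩ := h.exists_finset_opAlg_le h2
    obtain ⟨M, hM⟩ := h.exists_forall_letterOp_prod_eq_zero h2 L
    have hwf : WellFoundedLT {S : Submodule K P // opSpan (opAlg m f) S ≤ S} :=
      (strictMono_stablePair (m := m) (f := f)).wellFoundedLT
    exact eq_bot_of_le_opSpan_of_dcc (n := M) hmul hnil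
      (wordSpan_mono (Set.subset_univ _) le_rfl) hL
      (le_bot_iff.1 ((wordSpan_one_pow_le _ _).trans_eq (wordSpan_eq_bot hM)))
      hwf hJs hJ

/-- Under a chain condition on stable pairs, the only stable pair that is reproduced by the
multiplications is zero. -/
theorem eq_bot_of_isStable (h : IsPeircePair m f) (h2 : (2 : K) ≠ 0)
    (hchain : WellFoundedGT {Z // IsStable m f Z} ∨ WellFoundedLT {Z // IsStable m f Z})
    {Z : Submodule K P × Submodule K Q} (hZ : IsStable m f Z)
    (hP : Z.1 ≤ Submodule.map₂ m Z.2 ⊤ ⊔ Submodule.map₂ m ⊤ Z.1)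
    (hQ : Z.2 ≤ Submodule.map₂ f Z.1 ⊤) : Z = ⊥ := by
  have hbot : Z.1 = ⊥ := by
    refine h.eq_bot_of_le_opSpan h2 hchain
      (opSpan_opAlg_le hZ.act_mem fun u u' x hx => hZ.mem_act _ (hZ.form_mem x hx u) u')
      (hP.trans (sup_le (Submodule.map₂_le.2 fun v hv u _ => ?_)
        (Submodule.map₂_le.2 fun v _ x hx => apply_mem_opSpan (act_mem_opAlg v) hx)))
    have : Submodule.map₂ f Z.1 ⊤ ≤ (opSpan (opAlg m f) Z.1).comap (m.flip u) :=
      Submodule.map₂_le.2 fun x hx u' _ =>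
        apply_mem_opSpan (T := doubleOp m f u' u) (doubleOp_mem_opAlg u' u) hx
    exact this (hQ hv)
  refine Prod.ext hbot (le_bot_iff.1 (hQ.trans ?_))
  rw [hbot, Submodule.map₂_bot_left]

end IsPeircePair

end StablePairs

section BernsteinIdentities

variable {K A : Type*} [Field K] [NonUnitalNonAssocCommRing A] [Module K A]

lemma eq_zero_of_smul {c : K} (hc : c ≠ 0) {x : A} (h : c • x = 0) : x = 0 :=
  (smul_eq_zero.1 h).resolve_left hc

/-- Polarization of a quadratic condition. -/
lemma mul_mem_of_forall_mul_self_mem (h2 : (2 : K) ≠ 0) {S T : Submodule K A}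
    (h : ∀ x ∈ S, x * x ∈ T) {x y : A} (hx : x ∈ S) (hy : y ∈ S) : x * y ∈ T := by
  have h1 := T.sub_mem (T.sub_mem (h _ (S.add_mem hx hy)) (h _ hx)) (h _ hy)
  rw [← T.smul_mem_iff h2]
  convert h1 using 1
  rw [mul_add, add_mul, add_mul, mul_comm y x]
  module

variable [SMulCommClass K A A] [IsScalarTower K A A]

/-- `A` is a Bernstein algebra with weight `ω` over a field of characteristic `≠ 2, 3`, and `e` is
an idempotent of weight `1`. -/
structure IsBernstein (ω : A →ₗ[K] K) (e : A) : Prop where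
  two_ne_zero : (2 : K) ≠ 0
  three_ne_zero : (3 : K) ≠ 0
  weight_mul : ∀ x y : A, ω (x * y) = ω x * ω y
  sq_mul_sq : ∀ x : A, (x * x) * (x * x) = ω x ^ 2 • (x * x)
  idem : e * e = e
  weight_idem : ω e = 1

lemma mem_peirceU {e u : A} : u ∈ peirceU K e ↔ e * u = (2 : K)⁻¹ • u := Iff.rfl

lemma mem_peirceV {e v : A} : v ∈ peirceV K e ↔ e * v = 0 := Iff.rfl

namespace IsBernstein

variable {ω : A →ₗ[K] K} {e : A}

lemma weight_eq_zero_of_mem_peirceU (h : IsBernstein ω e) {u : A} (hu : u ∈ peirceU K e) :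
    ω u = 0 := by
  have h2 := h.two_ne_zero
  have := congrArg ω (mem_peirceU.1 hu)
  rw [h.weight_mul, h.weight_idem, map_smul, smul_eq_mul, one_mul] at this
  have h4 : 2 * ω u = ω u := by
    nth_rewrite 1 [this]
    rw [← mul_assoc, mul_inv_cancel₀ h2, one_mul]
  linear_combination h4

lemma weight_eq_zero_of_mem_peirceV (h : IsBernstein ω e) {v : A} (hv : v ∈ peirceV K e) :
    ω v = 0 := by
  have := congrArg ω (mem_peirceV.1 hv)
  rwa [h.weight_mul, h.weight_idem, one_mul, map_zero] at this

lemma expansion (h : IsBernstein ω e) {y : A} (hy : ω y = 0) :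
    ((4 : K) • (e * (e * y)) - (2 : K) • (e * y)) +
      ((4 : K) • ((e * y) * (e * y)) + (2 : K) • (e * (y * y)) - y * y) +
      (4 : K) • ((e * y) * (y * y)) + (y * y) * (y * y) = 0 := by
  have hsq : (e + y) * (e + y) = e + (2 : K) • (e * y) + y * y := by
    rw [mul_add, add_mul, add_mul, h.idem, mul_comm y e]
    module
  have := h.sq_mul_sq (e + y)
  rw [hsq, map_add, hy, h.weight_idem] at this
  simp only [mul_add, add_mul, mul_smul_comm, smul_mul_assoc, h.idem, mul_comm _ e,
    mul_comm (y * y) (e * y)] at this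
  linear_combination (norm := module) this

lemma identities (h : IsBernstein ω e) {y : A} (hy : ω y = 0) :
    (2 : K) • (e * (e * y)) = e * y ∧
      (4 : K) • ((e * y) * (e * y)) + (2 : K) • (e * (y * y)) = y * y ∧
      (e * y) * (y * y) = 0 ∧ (y * y) * (y * y) = 0 := by
  have key : ∀ c : K, c • ((4 : K) • (e * (e * y)) - (2 : K) • (e * y)) +
      c ^ 2 • ((4 : K) • ((e * y) * (e * y)) + (2 : K) • (e * (y * y)) - y * y) +
      c ^ 3 • ((4 : K) • ((e * y) * (y * y))) + c ^ 4 • ((y * y) * (y * y)) = 0 := by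
    intro c
    have := h.expansion (y := c • y) (by rw [map_smul, hy, smul_zero])
    simp only [mul_smul_comm, smul_mul_assoc] at this
    linear_combination (norm := module) this
  have h2 := h.two_ne_zero
  have h12 : (12 : K) ≠ 0 := by
    rw [show (12 : K) = 2 * 2 * 3 by norm_num]
    exact mul_ne_zero (mul_ne_zero h2 h2) h.three_ne_zero
  have k1 := key 1
  have k2 := key (-1)
  have k3 := key 2
  have k4 := key (-2)
  set c1 := (4 : K) • (e * (e * y)) - (2 : K) • (e * y) with hc1
  set c2 := (4 : K) • ((e * y) * (e * y)) + (2 : K) • (e * (y * y)) - y * y with hc2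
  have e4 : (y * y) * (y * y) = 0 := by
    refine eq_zero_of_smul (c := 2 * 12) (mul_ne_zero h2 h12) ?_
    linear_combination (norm := module) k3 + k4 - (4 : K) • k1 - (4 : K) • k2
  have e3 : (e * y) * (y * y) = 0 := by
    refine eq_zero_of_smul (c := 2 * 2 * 12) (mul_ne_zero (mul_ne_zero h2 h2) h12) ?_
    linear_combination (norm := module) k3 - k4 - (2 : K) • k1 + (2 : K) • k2
  have e2 : c2 = 0 := by
    refine eq_zero_of_smul h2 ?_
    linear_combination (norm := module) k1 + k2 - (2 : K) • e4
  have e1 : c1 = 0 := by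
    refine eq_zero_of_smul h2 ?_
    linear_combination (norm := module) k1 - k2 - (8 : K) • e3
  refine ⟨?_, sub_eq_zero.1 e2, e3, e4⟩
  refine sub_eq_zero.1 (eq_zero_of_smul h2 ?_)
  rw [← e1, hc1]
  module

lemma ker_weight_le (h : IsBernstein ω e) : LinearMap.ker ω ≤ peirceU K e ⊔ peirceV K e := by
  intro y hy
  have h1 := (h.identities (LinearMap.mem_ker.1 hy)).1
  refine Submodule.mem_sup.2 ⟨(2 : K) • (e * y), ?_, y - (2 : K) • (e * y), ?_, by abel⟩
  · rw [mem_peirceU, mul_smul_comm, h1, inv_smul_smul₀ h.two_ne_zero]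
  · rw [mem_peirceV, mul_sub, mul_smul_comm, h1, sub_self]

lemma mul_self_mem_peirceV (h : IsBernstein ω e) {u : A} (hu : u ∈ peirceU K e) :
    u * u ∈ peirceV K e := by
  have h2 := h.two_ne_zero
  have := (h.identities (h.weight_eq_zero_of_mem_peirceU hu)).2.1
  rw [mem_peirceU.1 hu, smul_mul_smul_comm, smul_smul,
    show (4 : K) * (2⁻¹ * 2⁻¹) = 1 by field_simp; norm_num, one_smul] at this
  exact eq_zero_of_smul h2 (by simpa using this)

lemma mul_self_mem_peirceU (h : IsBernstein ω e) {v : A} (hv : v ∈ peirceV K e) :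
    v * v ∈ peirceU K e := by
  have := (h.identities (h.weight_eq_zero_of_mem_peirceV hv)).2.1
  rw [mem_peirceV.1 hv, mul_zero, smul_zero, zero_add] at this
  rw [mem_peirceU, ← inv_smul_smul₀ h.two_ne_zero (e * (v * v)), this]

lemma mul_mem_peirceV (h : IsBernstein ω e) {u u' : A} (hu : u ∈ peirceU K e)
    (hu' : u' ∈ peirceU K e) : u * u' ∈ peirceV K e :=
  mul_mem_of_forall_mul_self_mem h.two_ne_zero (fun _ => h.mul_self_mem_peirceV) hu hu'

lemma mul_mem_peirceU_of_mem_peirceV (h : IsBernstein ω e) {v v' : A} (hv : v ∈ peirceV K e)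
    (hv' : v' ∈ peirceV K e) : v * v' ∈ peirceU K e :=
  mul_mem_of_forall_mul_self_mem h.two_ne_zero (fun _ => h.mul_self_mem_peirceU) hv hv'

lemma mul_mem_peirceU (h : IsBernstein ω e) {u v : A} (hu : u ∈ peirceU K e)
    (hv : v ∈ peirceV K e) : v * u ∈ peirceU K e := by
  have h2 := h.two_ne_zero
  have := (h.identities (y := u + v) (by
    rw [map_add, h.weight_eq_zero_of_mem_peirceU hu, h.weight_eq_zero_of_mem_peirceV hv,
      add_zero])).2.1
  have huu := mem_peirceV.1 (h.mul_self_mem_peirceV hu)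
  have hvv := (h.identities (h.weight_eq_zero_of_mem_peirceV hv)).2.1
  have huu' := (h.identities (h.weight_eq_zero_of_mem_peirceU hu)).2.1
  rw [mem_peirceV.1 hv, mul_zero, smul_zero, zero_add] at hvv
  rw [mul_add, mem_peirceV.1 hv, add_zero] at this
  simp only [mul_add, add_mul, mul_comm u v] at this
  rw [mem_peirceU, ← sub_eq_zero]
  refine eq_zero_of_smul (mul_ne_zero h2 h2) ?_
  rw [smul_sub, smul_smul (2 * 2 : K), mul_assoc, mul_inv_cancel₀ h2, mul_one]
  linear_combination (norm := module) this - huu' - hvv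

lemma cube_eq_zero (h : IsBernstein ω e) {u : A} (hu : u ∈ peirceU K e) : u * (u * u) = 0 := by
  have := (h.identities (h.weight_eq_zero_of_mem_peirceU hu)).2.2.1
  rw [mem_peirceU.1 hu, smul_mul_assoc] at this
  exact eq_zero_of_smul (inv_ne_zero h.two_ne_zero) this

lemma mul_sq_add (h : IsBernstein ω e) {u v : A} (hu : u ∈ peirceU K e) (hv : v ∈ peirceV K e) :
    (2 : K) • (u * (v * u)) + u * (v * v) = 0 := by
  have := (h.identities (y := u + v) (by
    rw [map_add, h.weight_eq_zero_of_mem_peirceU hu, h.weight_eq_zero_of_mem_peirceV hv,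
      add_zero])).2.2.1
  rw [mul_add, mem_peirceU.1 hu, mem_peirceV.1 hv, add_zero, smul_mul_assoc] at this
  have := eq_zero_of_smul (inv_ne_zero h.two_ne_zero) this
  simp only [mul_add, add_mul, h.cube_eq_zero hu, mul_comm u v] at this
  linear_combination (norm := module) this

lemma mul_sq_eq_zero (h : IsBernstein ω e) {u v : A} (hu : u ∈ peirceU K e)
    (hv : v ∈ peirceV K e) : u * (v * v) = 0 := by
  have h1 := h.mul_sq_add hu hv
  have h3 := h.mul_sq_add hu (neg_mem hv)
  simp only [neg_mul, mul_neg, neg_neg] at h3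
  refine eq_zero_of_smul h.two_ne_zero ?_
  linear_combination (norm := module) h1 + h3

lemma mul_act_eq_zero (h : IsBernstein ω e) {u v : A} (hu : u ∈ peirceU K e)
    (hv : v ∈ peirceV K e) : u * (v * u) = 0 := by
  have h1 := h.mul_sq_add hu hv
  rw [h.mul_sq_eq_zero hu hv, add_zero] at h1
  exact eq_zero_of_smul h.two_ne_zero h1

lemma mul_act_comm (h : IsBernstein ω e) {u u' v : A} (hu : u ∈ peirceU K e)
    (hu' : u' ∈ peirceU K e) (hv : v ∈ peirceV K e) : u * (v * u') = -(u' * (v * u)) := by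
  have := h.mul_act_eq_zero (add_mem hu hu') hv
  simp only [mul_add, add_mul, h.mul_act_eq_zero hu hv, h.mul_act_eq_zero hu' hv, zero_add,
    add_zero] at this
  rw [add_comm] at this
  exact eq_neg_of_add_eq_zero_left this

lemma mul_mul_eq_zero (h : IsBernstein ω e) {u v v' : A} (hu : u ∈ peirceU K e)
    (hv : v ∈ peirceV K e) (hv' : v' ∈ peirceV K e) : u * (v * v') = 0 :=
  LinearMap.mem_ker.1 (mul_mem_of_forall_mul_self_mem (T := LinearMap.ker (LinearMap.mulLeft K u))
    h.two_ne_zero (fun _ hv => LinearMap.mem_ker.2 (h.mul_sq_eq_zero hu hv)) hv hv')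

lemma sq_mul_eq_zero (h : IsBernstein ω e) {u w : A} (hu : u ∈ peirceU K e)
    (hw : w ∈ peirceU K e) (huw : u * w = 0) : (u * u) * w = 0 := by
  have h1 := h.cube_eq_zero (add_mem hu hw)
  have h3 := h.cube_eq_zero (sub_mem hu hw)
  simp only [mul_add, add_mul, mul_sub, sub_mul, mul_comm w u, huw, h.cube_eq_zero hu,
    h.cube_eq_zero hw, mul_neg, sub_zero, zero_sub, add_zero, zero_add] at h1 h3
  refine eq_zero_of_smul h.two_ne_zero ?_
  rw [mul_comm]
  linear_combination (norm := module) h1 - h3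

lemma act_mul_act_self (h : IsBernstein ω e) {u v : A} (hu : u ∈ peirceU K e)
    (hv : v ∈ peirceV K e) : (v * u) * (v * u) = 0 := by
  have h2 := h.two_ne_zero
  have hω : ∀ {v}, v ∈ peirceV K e → ω (u + v) = 0 := fun hv => by
    rw [map_add, h.weight_eq_zero_of_mem_peirceU hu, h.weight_eq_zero_of_mem_peirceV hv, add_zero]
  have h1 := (h.identities (hω hv)).2.2.2
  have h3 := (h.identities (hω (neg_mem hv))).2.2.2
  have h4 := h.sq_mul_eq_zero hu (h.mul_self_mem_peirceU hv) (h.mul_sq_eq_zero hu hv)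
  have h5 := (h.identities (h.weight_eq_zero_of_mem_peirceU hu)).2.2.2
  have h6 := (h.identities (h.weight_eq_zero_of_mem_peirceV hv)).2.2.2
  simp only [mul_add, add_mul, mul_neg, neg_mul, mul_comm u v, h5, h6, h4,
    mul_comm (v * v) (u * u), mul_comm (u * u) (v * u), mul_comm (v * v) (v * u)] at h1 h3
  refine eq_zero_of_smul (c := 2 * 2 * 2) (mul_ne_zero (mul_ne_zero h2 h2) h2) ?_
  linear_combination (norm := module) h1 + h3

lemma act_mul_act (h : IsBernstein ω e) {u u' v : A} (hu : u ∈ peirceU K e)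
    (hu' : u' ∈ peirceU K e) (hv : v ∈ peirceV K e) : (v * u) * (v * u') = 0 := by
  have := h.act_mul_act_self (add_mem hu hu') hv
  simp only [mul_add, add_mul, h.act_mul_act_self hu hv, h.act_mul_act_self hu' hv, zero_add,
    add_zero, mul_comm (v * u') (v * u)] at this
  refine eq_zero_of_smul h.two_ne_zero ?_
  linear_combination (norm := module) this

end IsBernstein

end BernsteinIdentities

section PeirceQuotient

variable {K A : Type*} [Field K] [NonUnitalNonAssocCommRing A] [Module K A]

lemma wellFoundedGT_ideals (hchain : ∀ f : ℕ → Submodule K A,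
    (∀ k, ∀ a : A, ∀ x ∈ f k, a * x ∈ f k) → Monotone f → ∃ n, ∀ m, n ≤ m → f m = f n) :
    WellFoundedGT {S : Submodule K A // ∀ a : A, ∀ x ∈ S, a * x ∈ S} := by
  refine wellFoundedGT_iff_monotone_chain_condition.2 fun f => ?_
  obtain ⟨n, hn⟩ := hchain (fun k => (f k).1) (fun k => (f k).2) fun _ _ hij => f.mono hij
  exact ⟨n, fun m hm => Subtype.ext (hn m hm).symm⟩

lemma wellFoundedLT_ideals (hchain : ∀ f : ℕ → Submodule K A,
    (∀ k, ∀ a : A, ∀ x ∈ f k, a * x ∈ f k) → Antitone f → ∃ n, ∀ m, n ≤ m → f m = f n) :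
    WellFoundedLT {S : Submodule K A // ∀ a : A, ∀ x ∈ S, a * x ∈ S} := by
  refine (wellFoundedGT_dual_iff _).1 (wellFoundedGT_iff_monotone_chain_condition.2 fun f => ?_)
  obtain ⟨n, hn⟩ := hchain (fun k => (OrderDual.ofDual (f k)).1)
    (fun k => (OrderDual.ofDual (f k)).2) fun _ _ hij => f.mono hij
  exact ⟨n, fun m hm => Subtype.ext (hn m hm).symm⟩

variable [SMulCommClass K A A] [IsScalarTower K A A]

/-- The annihilator of `U` in `U`. -/
def annU (K : Type*) {A : Type*} [Field K] [NonUnitalNonAssocCommRing A] [Module K A]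
    [SMulCommClass K A A] [IsScalarTower K A A] (e : A) : Submodule K (peirceU K e) where
  carrier := {u | ∀ w ∈ peirceU K e, (u : A) * w = 0}
  add_mem' ha hb w hw := by
    rw [Submodule.coe_add, add_mul, ha w hw, hb w hw, add_zero]
  zero_mem' w _ := by simp
  smul_mem' c x hx w hw := by rw [Submodule.coe_smul, smul_mul_assoc, hx w hw, smul_zero]

lemma mem_annU {e : A} {u : peirceU K e} :
    u ∈ annU K e ↔ ∀ w ∈ peirceU K e, (u : A) * w = 0 := Iff.rfl

lemma mul_mem_of_subMul_eq {e : A} {I : Submodule K A}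
    (hNI : subMul (peirceU K e ⊔ peirceV K e) I = I) {n x : A}
    (hn : n ∈ peirceU K e ⊔ peirceV K e) (hx : x ∈ I) : n * x ∈ I :=
  hNI.le (Submodule.apply_mem_map₂ _ hn hx)

namespace IsBernstein

variable {ω : A →ₗ[K] K} {e : A}

lemma act_mem_annU (h : IsBernstein ω e) {u : peirceU K e} (hu : u ∈ annU K e) {v : A}
    (hv : v ∈ peirceV K e) : ⟨v * u, h.mul_mem_peirceU u.2 hv⟩ ∈ annU K e := by
  intro w hw
  change (v * (u : A)) * w = 0
  rw [mul_comm, h.mul_act_comm hw u.2 hv, hu _ (h.mul_mem_peirceU hw hv), neg_zero]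

lemma act_act_mem_annU (h : IsBernstein ω e) (u : peirceU K e) {v : A} (hv : v ∈ peirceV K e) :
    ⟨v * (v * u), h.mul_mem_peirceU (h.mul_mem_peirceU u.2 hv) hv⟩ ∈ annU K e := by
  intro w hw
  change (v * (v * (u : A))) * w = 0
  rw [mul_comm, h.mul_act_comm hw (h.mul_mem_peirceU u.2 hv) hv, h.act_mul_act u.2 hw hv, neg_zero]

lemma mul_mem_annU (h : IsBernstein ω e) {v v' : A} (hv : v ∈ peirceV K e)
    (hv' : v' ∈ peirceV K e) :
    ⟨v * v', h.mul_mem_peirceU_of_mem_peirceV hv hv'⟩ ∈ annU K e := by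
  intro w hw
  change (v * v') * w = 0
  rw [mul_comm, h.mul_mul_eq_zero hw hv hv']

/-- The multiplication `V × U → U`. -/
def mulVU (h : IsBernstein ω e) : peirceV K e →ₗ[K] peirceU K e →ₗ[K] peirceU K e :=
  LinearMap.mk₂ K (fun v u => ⟨(v : A) * u, h.mul_mem_peirceU u.2 v.2⟩)
    (fun _ _ _ => Subtype.ext (add_mul _ _ _)) (fun _ _ _ => Subtype.ext (smul_mul_assoc _ _ _))
    (fun _ _ _ => Subtype.ext (mul_add _ _ _)) (fun _ _ _ => Subtype.ext (mul_smul_comm _ _ _))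

/-- The multiplication `U × U → V`. -/
def mulUU (h : IsBernstein ω e) : peirceU K e →ₗ[K] peirceU K e →ₗ[K] peirceV K e :=
  LinearMap.mk₂ K (fun u u' => ⟨(u : A) * u', h.mul_mem_peirceV u.2 u'.2⟩)
    (fun _ _ _ => Subtype.ext (add_mul _ _ _)) (fun _ _ _ => Subtype.ext (smul_mul_assoc _ _ _))
    (fun _ _ _ => Subtype.ext (mul_add _ _ _)) (fun _ _ _ => Subtype.ext (mul_smul_comm _ _ _))

/-- The action of `V` on `U / ann_U(U)`. -/
def act (h : IsBernstein ω e) :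
    peirceV K e →ₗ[K] (peirceU K e ⧸ annU K e) →ₗ[K] (peirceU K e ⧸ annU K e) where
  toFun v := (annU K e).mapQ (annU K e) (h.mulVU v) fun _ hu => h.act_mem_annU hu v.2
  map_add' _ _ := Submodule.linearMap_qext _ (LinearMap.ext fun _ => by simp; rfl)
  map_smul' _ _ := Submodule.linearMap_qext _ (LinearMap.ext fun _ => by simp; rfl)

/-- The symmetric bilinear map on `U / ann_U(U)` induced by the multiplication `U × U → V`. -/
def form (h : IsBernstein ω e) :
    (peirceU K e ⧸ annU K e) →ₗ[K] (peirceU K e ⧸ annU K e) →ₗ[K] peirceV K e :=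
  (annU K e).liftQ
    { toFun := fun u => (annU K e).liftQ (h.mulUU u) fun w hw =>
        LinearMap.mem_ker.2 (Subtype.ext ((mul_comm _ _).trans (hw u u.2)))
      map_add' := fun _ _ => Submodule.linearMap_qext _ (LinearMap.ext fun _ => by simp)
      map_smul' := fun _ _ => Submodule.linearMap_qext _ (LinearMap.ext fun _ => by simp) }
    fun w hw => LinearMap.mem_ker.2 (Submodule.linearMap_qext _ (LinearMap.ext fun u =>
      Subtype.ext (hw u u.2)))

@[simp] lemma act_mk (h : IsBernstein ω e) (v : peirceV K e) (u : peirceU K e) :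
    h.act v (Submodule.Quotient.mk u) =
      Submodule.Quotient.mk ⟨(v : A) * u, h.mul_mem_peirceU u.2 v.2⟩ := rfl

@[simp] lemma form_mk (h : IsBernstein ω e) (u u' : peirceU K e) :
    h.form (Submodule.Quotient.mk u) (Submodule.Quotient.mk u') =
      ⟨(u : A) * u', h.mul_mem_peirceV u.2 u'.2⟩ := rfl

lemma isPeircePair (h : IsBernstein ω e) : IsPeircePair h.act h.form where
  symm x y := by
    induction x using Submodule.Quotient.induction_on with | _ x
    induction y using Submodule.Quotient.induction_on with | _ y
    exact Subtype.ext (mul_comm _ _)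
  act_act v x := by
    induction x using Submodule.Quotient.induction_on with | _ x
    exact (Submodule.Quotient.mk_eq_zero _).2 (h.act_act_mem_annU x v.2)
  form_act v x := by
    induction x using Submodule.Quotient.induction_on with | _ x
    exact Subtype.ext (h.mul_act_eq_zero x.2 v.2)
  cube x := by
    induction x using Submodule.Quotient.induction_on with | _ x
    refine (congrArg Submodule.Quotient.mk (Subtype.ext ?_)).trans (Submodule.Quotient.mk_zero _)
    exact (mul_comm _ _).trans (h.cube_eq_zero x.2)

/-- Every element is a sum of a multiple of `e`, an element of `U` and an element of `V`. -/
lemma exists_eq_add (h : IsBernstein ω e) (a : A) :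
    ∃ c : K, ∃ u ∈ peirceU K e, ∃ v ∈ peirceV K e, a = c • e + (u + v) := by
  obtain ⟨u, hu, v, hv, huv⟩ := Submodule.mem_sup.1 (h.ker_weight_le
    (LinearMap.mem_ker.2 (show ω (a - ω a • e) = 0 by simp [h.weight_idem])))
  exact ⟨ω a, u, hu, v, hv, by rw [huv]; abel⟩

lemma add_eq_add (h : IsBernstein ω e) {u u' v v' : A} (hu : u ∈ peirceU K e)
    (hu' : u' ∈ peirceU K e) (hv : v ∈ peirceV K e) (hv' : v' ∈ peirceV K e)
    (huv : u + v = u' + v') : u = u' ∧ v = v' := by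
  have := congrArg (e * ·) huv
  simp only [mul_add, mem_peirceU.1 hu, mem_peirceU.1 hu', mem_peirceV.1 hv, mem_peirceV.1 hv',
    add_zero] at this
  have := smul_right_injective A (inv_ne_zero h.two_ne_zero) this
  subst this
  exact ⟨rfl, add_left_cancel huv⟩

/-- The ideal of `A` attached to a stable pair of subspaces of `U / ann_U(U)` and `V`. -/
def idealOfPair (Z : Submodule K (peirceU K e ⧸ annU K e) × Submodule K (peirceV K e)) :
    Submodule K A :=
  (Z.1.comap (annU K e).mkQ).map (peirceU K e).subtype ⊔ Z.2.map (peirceV K e).subtype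

lemma mem_idealOfPair {Z : Submodule K (peirceU K e ⧸ annU K e) × Submodule K (peirceV K e)}
    {x : A} : x ∈ idealOfPair Z ↔ ∃ u : peirceU K e, ∃ v : peirceV K e,
      Submodule.Quotient.mk u ∈ Z.1 ∧ v ∈ Z.2 ∧ (u : A) + v = x := by
  simp only [idealOfPair, Submodule.mem_sup]
  constructor
  · rintro ⟨_, ⟨u, hu, rfl⟩, _, ⟨v, hv, rfl⟩, rfl⟩
    exact ⟨u, v, hu, hv, rfl⟩
  · rintro ⟨u, v, hu, hv, rfl⟩
    exact ⟨_, ⟨u, hu, rfl⟩, _, ⟨v, hv, rfl⟩, rfl⟩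

lemma mul_mem_idealOfPair (h : IsBernstein ω e)
    {Z : Submodule K (peirceU K e ⧸ annU K e) × Submodule K (peirceV K e)}
    (hZ : IsStable h.act h.form Z) (a : A) {x : A} (hx : x ∈ idealOfPair Z) :
    a * x ∈ idealOfPair Z := by
  obtain ⟨u, v, hu, hv, rfl⟩ := mem_idealOfPair.1 hx
  obtain ⟨c, u', hu', v', hv', rfl⟩ := h.exists_eq_add a
  refine mem_idealOfPair.2 ⟨(c * 2⁻¹) • u + ⟨v * u', h.mul_mem_peirceU hu' v.2⟩ +
    ⟨v' * u, h.mul_mem_peirceU u.2 hv'⟩ + ⟨v' * v, h.mul_mem_peirceU_of_mem_peirceV hv' v.2⟩,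
    ⟨u * u', h.mul_mem_peirceV u.2 hu'⟩, ?_, hZ.form_mem _ hu (Submodule.Quotient.mk ⟨u', hu'⟩), ?_⟩
  · simp only [Submodule.Quotient.mk_add, Submodule.Quotient.mk_smul]
    refine add_mem (add_mem (add_mem (Submodule.smul_mem _ _ hu)
      (hZ.mem_act _ hv (Submodule.Quotient.mk ⟨u', hu'⟩))) (hZ.act_mem ⟨v', hv'⟩ _ hu)) ?_
    rw [(Submodule.Quotient.mk_eq_zero _).2 (h.mul_mem_annU hv' v.2)]
    exact zero_mem _
  · simp only [Submodule.coe_add, Submodule.coe_smul, add_mul, mul_add, smul_mul_assoc,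
      mem_peirceU.1 u.2, mem_peirceV.1 v.2, mul_comm u' _]
    module

lemma le_of_idealOfPair_le (h : IsBernstein ω e)
    {Z Z' : Submodule K (peirceU K e ⧸ annU K e) × Submodule K (peirceV K e)}
    (hZ : idealOfPair Z ≤ idealOfPair Z') : Z ≤ Z' := by
  refine ⟨fun x hx => ?_, fun v hv => ?_⟩
  · induction x using Submodule.Quotient.induction_on with | _ u
    obtain ⟨u', v', hu', -, huv⟩ :=
      mem_idealOfPair.1 (hZ (mem_idealOfPair.2 ⟨u, 0, hx, zero_mem _, rfl⟩))
    have := (h.add_eq_add u'.2 u.2 v'.2 (zero_mem _) huv).1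
    rwa [← Subtype.ext this]
  · obtain ⟨u', v', -, hv', huv⟩ :=
      mem_idealOfPair.1 (hZ (mem_idealOfPair.2 ⟨0, v, zero_mem _, hv, rfl⟩))
    have := (h.add_eq_add u'.2 (zero_mem _) v'.2 v.2 huv).2
    rwa [← Subtype.ext this]

lemma strictMono_idealOfPair (h : IsBernstein ω e) :
    StrictMono fun Z : {Z // IsStable h.act h.form Z} =>
      (⟨idealOfPair Z.1, fun a _ hx => h.mul_mem_idealOfPair Z.2 a hx⟩ :
        {S : Submodule K A // ∀ a : A, ∀ x ∈ S, a * x ∈ S}) := by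
  refine Monotone.strictMono_of_injective (fun Z Z' hZ => ?_) fun Z Z' hZ => ?_
  · exact sup_le_sup (α := Submodule K A) (Submodule.map_mono (Submodule.comap_mono hZ.1))
      (Submodule.map_mono hZ.2)
  · have hZ' := congrArg Subtype.val hZ
    exact Subtype.ext (le_antisymm (h.le_of_idealOfPair_le hZ'.le) (h.le_of_idealOfPair_le hZ'.ge))

lemma le_barideal (h : IsBernstein ω e) {I : Submodule K A}
    (hNI : subMul (peirceU K e ⊔ peirceV K e) I = I) : I ≤ peirceU K e ⊔ peirceV K e := by
  refine hNI.ge.trans ((Submodule.map₂_le.2 fun n hn x _ => ?_).trans h.ker_weight_le)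
  obtain ⟨u, hu, v, hv, rfl⟩ := Submodule.mem_sup.1 hn
  rw [LinearMap.mem_ker, LinearMap.mul_apply', h.weight_mul, map_add,
    h.weight_eq_zero_of_mem_peirceU hu, h.weight_eq_zero_of_mem_peirceV hv, add_zero, zero_mul]

/-- The pairs of Peirce components of the elements of `I`. -/
def components (I : Submodule K A) (e : A) : Submodule K (peirceU K e × peirceV K e) :=
  I.comap ((peirceU K e).subtype.coprod (peirceV K e).subtype)

lemma mem_components {I : Submodule K A} {z : peirceU K e × peirceV K e} :
    z ∈ components I e ↔ (z.1 : A) + z.2 ∈ I := Iff.rfl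

/-- The images in `U / ann_U(U)` and `V` of the Peirce components of the elements of `I`. -/
def componentPair (I : Submodule K A) (e : A) :
    Submodule K (peirceU K e ⧸ annU K e) × Submodule K (peirceV K e) :=
  ((components I e).map ((annU K e).mkQ.comp (LinearMap.fst K _ _)),
    (components I e).map (LinearMap.snd K _ _))

lemma fst_mem {I : Submodule K A} {u : peirceU K e} {v : peirceV K e} (h : (u : A) + v ∈ I) :
    Submodule.Quotient.mk u ∈ (componentPair I e).1 := ⟨(u, v), h, rfl⟩

lemma snd_mem {I : Submodule K A} {u : peirceU K e} {v : peirceV K e} (h : (u : A) + v ∈ I) :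
    v ∈ (componentPair I e).2 := ⟨(u, v), h, rfl⟩

lemma isStable_componentPair (h : IsBernstein ω e) {I : Submodule K A}
    (hNI : subMul (peirceU K e ⊔ peirceV K e) I = I) :
    IsStable h.act h.form (componentPair I e) where
  act_mem := by
    rintro v _ ⟨⟨u, v'⟩, huv, rfl⟩
    have := mul_mem_of_subMul_eq hNI (Submodule.mem_sup_right v.2) huv
    have h1 := fst_mem (u := ⟨v * u, h.mul_mem_peirceU u.2 v.2⟩ +
      ⟨v * v', h.mul_mem_peirceU_of_mem_peirceV v.2 v'.2⟩) (v := (0 : peirceV K e)) (I := I) (by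
        simpa [mul_add] using this)
    rwa [Submodule.Quotient.mk_add, (Submodule.Quotient.mk_eq_zero _).2 (h.mul_mem_annU v.2 v'.2),
      add_zero] at h1
  mem_act := by
    rintro _ ⟨⟨u, v⟩, huv, rfl⟩ x
    induction x using Submodule.Quotient.induction_on with | _ u'
    have := mul_mem_of_subMul_eq hNI (Submodule.mem_sup_left u'.2) huv
    exact fst_mem (u := ⟨(v : A) * u', h.mul_mem_peirceU u'.2 v.2⟩)
      (v := ⟨(u' : A) * u, h.mul_mem_peirceV u'.2 u.2⟩) (by
        simpa [mul_add, mul_comm (v : A), add_comm] using this)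
  form_mem := by
    rintro _ ⟨⟨u, v⟩, huv, rfl⟩ x
    induction x using Submodule.Quotient.induction_on with | _ u'
    have := mul_mem_of_subMul_eq hNI (Submodule.mem_sup_left u'.2) huv
    exact snd_mem (u := ⟨(v : A) * u', h.mul_mem_peirceU u'.2 v.2⟩)
      (v := ⟨(u : A) * u', h.mul_mem_peirceV u.2 u'.2⟩) (by
        simpa [mul_add, mul_comm (v : A), mul_comm (u : A), add_comm] using this)

lemma componentPair_le (h : IsBernstein ω e) {I : Submodule K A}
    (hNI : subMul (peirceU K e ⊔ peirceV K e) I = I) :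
    componentPair I e ≤ (Submodule.map₂ h.act (componentPair I e).2 ⊤ ⊔
      Submodule.map₂ h.act ⊤ (componentPair I e).1,
        Submodule.map₂ h.form (componentPair I e).1 ⊤) := by
  set Z := componentPair I e with hZ
  set Z' := (Submodule.map₂ h.act Z.2 ⊤ ⊔ Submodule.map₂ h.act ⊤ Z.1,
    Submodule.map₂ h.form Z.1 ⊤) with hZ'
  have hI : I ≤ idealOfPair Z' := by
    refine hNI.ge.trans (Submodule.map₂_le.2 fun n hn x hx => ?_)
    obtain ⟨u', hu', v', hv', rfl⟩ := Submodule.mem_sup.1 hn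
    obtain ⟨u, hu, v, hv, rfl⟩ := Submodule.mem_sup.1 (h.le_barideal hNI hx)
    have h1 := fst_mem (u := ⟨u, hu⟩) (v := ⟨v, hv⟩) hx
    have h3 := snd_mem (u := ⟨u, hu⟩) (v := ⟨v, hv⟩) hx
    refine mem_idealOfPair.2 ⟨⟨v * u', h.mul_mem_peirceU hu' hv⟩ +
      ⟨v' * u, h.mul_mem_peirceU hu hv'⟩ + ⟨v' * v, h.mul_mem_peirceU_of_mem_peirceV hv' hv⟩,
      ⟨u * u', h.mul_mem_peirceV hu hu'⟩, ?_, ?_, ?_⟩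
    · rw [Submodule.Quotient.mk_add, (Submodule.Quotient.mk_eq_zero _).2 (h.mul_mem_annU hv' hv),
        add_zero, Submodule.Quotient.mk_add]
      have h4 := Submodule.apply_mem_map₂ h.act h3
        (Submodule.mem_top (x := Submodule.Quotient.mk ⟨u', hu'⟩))
      have h5 := Submodule.apply_mem_map₂ h.act (Submodule.mem_top (x := ⟨v', hv'⟩)) h1
      exact add_mem (Submodule.mem_sup_left h4) (Submodule.mem_sup_right h5)
    · exact Submodule.apply_mem_map₂ h.form h1
        (Submodule.mem_top (x := Submodule.Quotient.mk ⟨u', hu'⟩))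
    · simp only [Submodule.coe_add, LinearMap.mul_apply', add_mul, mul_add, mul_comm u']
      abel
  have hcomp : ∀ z ∈ components I e, Submodule.Quotient.mk z.1 ∈ Z'.1 ∧ z.2 ∈ Z'.2 := by
    rintro ⟨u, v⟩ huv
    obtain ⟨u', v', hu', hv', heq⟩ := mem_idealOfPair.1 (hI huv)
    obtain ⟨h1, h3⟩ := h.add_eq_add u'.2 u.2 v'.2 v.2 heq
    obtain rfl := Subtype.ext h1
    obtain rfl := Subtype.ext h3
    exact ⟨hu', hv'⟩
  refine ⟨?_, ?_⟩
  · rintro _ ⟨z, hz, rfl⟩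
    exact (hcomp z hz).1
  · rintro _ ⟨z, hz, rfl⟩
    exact (hcomp z hz).2

/-- A subspace `I` with `NI = I` is contained in `ann_U(U)`. -/
theorem mem_of_subMul_eq (h : IsBernstein ω e)
    (hchain : WellFoundedGT {S : Submodule K A // ∀ a : A, ∀ x ∈ S, a * x ∈ S} ∨
      WellFoundedLT {S : Submodule K A // ∀ a : A, ∀ x ∈ S, a * x ∈ S}) {I : Submodule K A}
    (hNI : subMul (peirceU K e ⊔ peirceV K e) I = I) {x : A} (hx : x ∈ I) :
    x ∈ peirceU K e ∧ ∀ u ∈ peirceU K e, x * u = 0 := by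
  have hbot : componentPair I e = ⊥ :=
    h.isPeircePair.eq_bot_of_isStable h.two_ne_zero
      (hchain.imp (fun hwf => @StrictMono.wellFoundedGT _ _ _ _ _ hwf h.strictMono_idealOfPair)
        fun hwf => @StrictMono.wellFoundedLT _ _ _ _ _ hwf h.strictMono_idealOfPair)
      (h.isStable_componentPair hNI) (h.componentPair_le hNI).1 (h.componentPair_le hNI).2
  obtain ⟨u, hu, v, hv, rfl⟩ := Submodule.mem_sup.1 (h.le_barideal hNI hx)
  have h1 := fst_mem (u := ⟨u, hu⟩) (v := ⟨v, hv⟩) hx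
  have h3 := snd_mem (u := ⟨u, hu⟩) (v := ⟨v, hv⟩) hx
  rw [hbot] at h1 h3
  have hv0 : v = 0 := congrArg Subtype.val ((Submodule.mem_bot K).1 h3)
  have hu0 := (Submodule.Quotient.mk_eq_zero _).1 ((Submodule.mem_bot K).1 h1)
  rw [hv0, add_zero]
  exact ⟨hu, fun w hw => hu0 w hw⟩

end IsBernstein

end PeirceQuotient

/-- Let `A` be a Bernstein algebra over a field `K` of characteristic `≠ 2, 3`
which is Noetherian or Artinian, with Peirce decomposition `A = Ke ⊕ U ⊕ V` relative to an
idempotent `e` of weight `1`, and barideal `N = U ⊕ V`.  If `I` is a subspace of `A` with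
`NI = I`, then `I ⊆ ann_U(U) = {u ∈ U : uU = 0}` and `I` is an ideal of `A`. -/
theorem bernstein_chain_NI_eq_I_subset_annU {K A : Type*} [Field K]
    [NonUnitalNonAssocCommRing A] [Module K A] [SMulCommClass K A A] [IsScalarTower K A A]
    (h2 : (2 : K) ≠ 0) (h3 : (3 : K) ≠ 0)
    (ω : A →ₗ[K] K) (hωmul : ∀ x y : A, ω (x * y) = ω x * ω y) (hω0 : ω ≠ 0)
    (hbern : ∀ x : A, (x * x) * (x * x) = ω x ^ 2 • (x * x))
    (e : A) (he : e * e = e) (hωe : ω e = 1)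
    -- `A` is Noetherian or Artinian
    (hchain :
      (∀ f : ℕ → Submodule K A, (∀ k, ∀ a : A, ∀ x ∈ f k, a * x ∈ f k) → Monotone f →
        ∃ n, ∀ m, n ≤ m → f m = f n) ∨
      (∀ f : ℕ → Submodule K A, (∀ k, ∀ a : A, ∀ x ∈ f k, a * x ∈ f k) → Antitone f →
        ∃ n, ∀ m, n ≤ m → f m = f n))
    (I : Submodule K A)
    -- `NI = I`, where `N = U ⊕ V` is the barideal
    (hNI : subMul (peirceU K e ⊔ peirceV K e) I = I) :
    -- `I ⊆ ann_U(U)` :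
    (∀ x ∈ I, x ∈ peirceU K e ∧ ∀ u ∈ peirceU K e, x * u = 0) ∧
    -- `I` is an ideal of `A` :
    (∀ a : A, ∀ x ∈ I, a * x ∈ I) := by

  have h : IsBernstein ω e := ⟨h2, h3, hωmul, hbern, he, hωe⟩
  have hI := fun x hx => h.mem_of_subMul_eq (hchain.imp wellFoundedGT_ideals wellFoundedLT_ideals)
    hNI (x := x) hx
  refine ⟨hI, fun a x hx => ?_⟩
  obtain ⟨c, u, hu, v, hv, rfl⟩ := h.exists_eq_add a
  rw [add_mul, smul_mul_assoc, mem_peirceU.1 (hI x hx).1, smul_smul]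
  exact add_mem (I.smul_mem _ hx) (mul_mem_of_subMul_eq hNI (Submodule.add_mem_sup hu hv) hx)
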